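/- arXiv:2011.01409 — 6 statements merged into one kernel-verified Lean document; each statement's English description precedes it below -/
import Mathlib

section
/- (Giffen) Every knot is I-equivalent to the unknot: for every injective continuous map K : S¹ → ℝ³ there is a continuous injective map F : S¹ × Set.Icc (0:ℝ) 1 → ℝ³ × Set.Icc (0:ℝ) 1 such that F(x,0) = (K x, 0) and F(x,1) = (U x, 1) for all x, where U : S¹ → ℝ³ is the standard unknot U(x₁,x₂) = (x₁,x₂,0), and the second coordinate of F(x,t) lies in {0,1} only if t ∈ {0,1}. -/
/-- `ℝ³`: Euclidean 3-space. -/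
abbrev R3 : Type := EuclideanSpace ℝ (Fin 3)

/-- The unit circle `S¹ ⊆ ℝ²`. -/
abbrev Circle1 : Type := {x : EuclideanSpace ℝ (Fin 2) // ‖x‖ = 1}

/-- The unit interval `[0,1]`. -/
abbrev I01 : Type := Set.Icc (0 : ℝ) 1

/-- `0` as an element of `[0,1]`. -/
def i0 : I01 := ⟨0, by norm_num⟩

/-- `1` as an element of `[0,1]`. -/
def i1 : I01 := ⟨1, by norm_num⟩

/-- The standard unknot `U(x₁, x₂) = (x₁, x₂, 0)`. -/
noncomputable def unknot : Circle1 → R3 :=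
  fun x => (EuclideanSpace.equiv (Fin 3) ℝ).symm ![x.1 0, x.1 1, 0]

namespace GiffenKnot

open Set Topology Filter unitInterval

/-- Every nowhere vanishing continuous complex function on `X` has a continuous logarithm. -/
def HasLogs (X : Type*) [TopologicalSpace X] : Prop :=
  ∀ f : C(X, ℂ), (∀ x, f x ≠ 0) → ∃ φ : C(X, ℂ), ∀ x, Complex.exp (φ x) = f x

theorem HasLogs.of_simplyConnected {X : Type*} [TopologicalSpace X] [SimplyConnectedSpace X]
    [LocallyPathConnectedSpace X] : HasLogs X := by
  intro f hf
  obtain ⟨x₀⟩ : Nonempty X := inferInstance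
  obtain ⟨φ, ⟨-, hφ⟩, -⟩ := Complex.isCoveringMapOn_exp.existsUnique_continuousMap_lifts f
    (Complex.exp_log (hf x₀)) (fun x ↦ by simpa using hf x)
  exact ⟨φ, fun x ↦ congrFun hφ x⟩

theorem HasLogs.of_homeomorph {X Y : Type*} [TopologicalSpace X] [TopologicalSpace Y]
    (h : X ≃ₜ Y) (hX : HasLogs X) : HasLogs Y := by
  intro f hf
  obtain ⟨φ, hφ⟩ := hX (f.comp h) (fun x ↦ hf _)
  exact ⟨φ.comp (h.symm : C(Y, X)), fun y ↦ by simpa using hφ (h.symm y)⟩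

/-- Closeness to a function with a logarithm produces a logarithm. -/
theorem exists_log_of_norm_sub_lt {X : Type*} [TopologicalSpace X] (f : C(X, ℂ)) (ψ : C(X, ℂ))
    (h : ∀ x, ‖Complex.exp (ψ x) - f x‖ < ‖f x‖) :
    ∃ φ : C(X, ℂ), (∀ x, Complex.exp (φ x) = f x) ∧
      ∀ x, Complex.exp (ψ x) = f x → φ x = ψ x := by
  have hf : ∀ x, f x ≠ 0 := fun x hx ↦ by
    have := h x
    rw [hx, norm_zero] at this
    exact absurd this (not_lt.2 (norm_nonneg _))
  have hs : ∀ x, Complex.exp (ψ x) / f x ∈ Complex.slitPlane := by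
    intro x
    apply Complex.mem_slitPlane_of_norm_lt_one (z := Complex.exp (ψ x) / f x - 1) _ |> fun h ↦ by
      simpa using h
    rw [div_sub_one (hf x), norm_div, div_lt_one (norm_pos_iff.2 (hf x))]
    exact h x
  refine ⟨⟨fun x ↦ ψ x - Complex.log (Complex.exp (ψ x) / f x), ?_⟩, fun x ↦ ?_, fun x hx ↦ ?_⟩
  · refine ψ.continuous.sub (Continuous.clog ?_ hs)
    exact (Complex.continuous_exp.comp ψ.continuous).div f.continuous hf
  · have h1 : Complex.exp (ψ x) / f x ≠ 0 := Complex.slitPlane_ne_zero (hs x)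
    change Complex.exp (ψ x - Complex.log (Complex.exp (ψ x) / f x)) = f x
    rw [Complex.exp_sub, Complex.exp_log h1, div_div_cancel₀ (Complex.exp_ne_zero _)]
  · simp [hx, div_self (hf x)]

theorem HasLogs.of_isCompact_real {Z : Set ℝ} (hZ : IsCompact Z) : HasLogs Z := by
  intro f hf
  have : CompactSpace Z := isCompact_iff_compactSpace.1 hZ
  obtain ⟨m, hm, hmf⟩ : ∃ m > 0, ∀ x, m ≤ ‖f x‖ := by
    rcases isEmpty_or_nonempty Z with hE | hN
    · exact ⟨1, one_pos, fun x ↦ (hE.false x).elim⟩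
    · obtain ⟨x, -, hx⟩ := isCompact_univ.exists_isMinOn univ_nonempty
        f.continuous.norm.continuousOn
      exact ⟨‖f x‖, norm_pos_iff.2 (hf x), fun y ↦ hx (mem_univ y)⟩
  obtain ⟨F, hF⟩ := ContinuousMap.exists_extension hZ.isClosed.isClosedEmbedding_subtypeVal f
  replace hF : ∀ x : Z, F x = f x := fun x ↦ DFunLike.congr_fun hF x
  obtain ⟨r, hr⟩ := hZ.isBounded.subset_closedBall 0
  rw [Real.closedBall_eq_Icc] at hr
  obtain ⟨p, hp⟩ := exists_polynomial_near_of_continuousOn (0 - r) (0 + r) (fun x ↦ (F x).re)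
    (by fun_prop) (m / 4) (by positivity)
  obtain ⟨q, hq⟩ := exists_polynomial_near_of_continuousOn (0 - r) (0 + r) (fun x ↦ (F x).im)
    (by fun_prop) (m / 4) (by positivity)
  let P : ℝ → ℂ := fun x ↦ Complex.equivRealProdCLM.symm (p.eval x, q.eval x)
  have hPd : ContDiff ℝ 1 P := by
    refine Complex.equivRealProdCLM.symm.contDiff.comp ?_
    simpa using (p.contDiff_aeval (𝕜 := ℝ) (R := ℝ) 1).prodMk (q.contDiff_aeval (𝕜 := ℝ) (R := ℝ) 1)
  have hdense : Dense (range P)ᶜ := hPd.dense_compl_range_of_finrank_lt_finrank (by simp)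
  obtain ⟨v, hv, hvm⟩ := hdense.exists_dist_lt 0 (show 0 < m / 4 by positivity)
  rw [dist_zero_left] at hvm
  obtain ⟨ψ, hψ⟩ := (HasLogs.of_simplyConnected (X := ℝ)) ⟨fun x ↦ P x - v, by fun_prop⟩
    (fun x hx ↦ hv ⟨x, sub_eq_zero.1 hx⟩)
  refine (exists_log_of_norm_sub_lt f (ψ.comp ⟨Subtype.val, by fun_prop⟩) fun x ↦ ?_).imp
    fun _ h ↦ h.1
  have h1 := hp x (hr x.2)
  have h2 := hq x (hr x.2)
  rw [hF] at h1 h2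
  have h3 : ‖P x - f x‖ < m / 2 := by
    refine (Complex.norm_le_abs_re_add_abs_im _).trans_lt ?_
    have : |(P x - f x).re| + |(P x - f x).im| < m / 4 + m / 4 := by
      gcongr
      · simpa [P] using h1
      · simpa [P] using h2
    linarith
  calc ‖Complex.exp (ψ x) - f x‖ = ‖(P x - f x) - v‖ := by rw [hψ]; simp; ring_nf
    _ ≤ ‖P x - f x‖ + ‖v‖ := norm_sub_le _ _
    _ < m := by linarith
    _ ≤ ‖f x‖ := hmf x

theorem isPreconnected_lt_norm (ρ : ℝ) : IsPreconnected {v : ℂ | ρ < ‖v‖} := by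
  have h : {v : ℂ | ρ < ‖v‖} =
      (fun p : ℝ × ℝ ↦ (p.1 : ℂ) * Complex.exp (p.2 * Complex.I)) '' (Ioi ρ ×ˢ univ) := by
    ext v
    constructor
    · intro hv
      exact ⟨(‖v‖, v.arg), ⟨hv, mem_univ _⟩, Complex.norm_mul_exp_arg_mul_I v⟩
    · rintro ⟨p, ⟨hp, -⟩, rfl⟩
      simp only [mem_Ioi] at hp
      simpa [Complex.norm_exp_ofReal_mul_I] using hp.trans_le (le_abs_self _)
  rw [h]
  exact (isPreconnected_Ioi.prod isPreconnected_univ).image _ (by fun_prop)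

/-- The identity of the plane, suitably translated, has no logarithm on a large circle. -/
theorem not_exists_log_of_eq_sub (x : ℂ) (ρ : ℝ) (hρ : 0 < ρ) (ψ : ℂ → ℂ) (hψ : Continuous ψ)
    (h : ∀ y, ‖y - x‖ = ρ → Complex.exp (ψ y) = y - x) : False := by
  let f : ℝ → ℂ := fun θ ↦ ψ (x + ρ * Complex.exp (θ * Complex.I)) - θ * Complex.I - Real.log ρ
  have hf : ∀ θ, Complex.exp (f θ) = 1 := by
    intro θ
    have hρ' : (ρ : ℂ) ≠ 0 := by exact_mod_cast hρ.ne'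
    simp only [f]
    rw [Complex.exp_sub, Complex.exp_sub, h _ (by simp [Complex.norm_exp_ofReal_mul_I, hρ.le]),
      ← Complex.ofReal_exp, Real.exp_log hρ]
    have := Complex.exp_ne_zero (θ * Complex.I)
    field_simp
    simp
  have hfc : Continuous f := by fun_prop
  obtain ⟨g, -, hg⟩ := Complex.isCoveringMapOn_exp.existsUnique_continuousMap_lifts
    (A := ℝ) (ContinuousMap.const ℝ 1) (a₀ := 0) (e₀ := f 0) (by simpa using hf 0) (by simp)
  have h1 := hg ⟨f, hfc⟩ ⟨rfl, funext fun θ ↦ by simpa using hf θ⟩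
  have h2 := hg (ContinuousMap.const ℝ (f 0)) ⟨rfl, funext fun θ ↦ by simpa using hf 0⟩
  have h3 : f (2 * Real.pi) = f 0 := DFunLike.congr_fun (h1.trans h2.symm) (2 * Real.pi)
  have h4 : Complex.exp (2 * Real.pi * Complex.I) = 1 := Complex.exp_two_pi_mul_I
  simp [f, h4, Real.pi_ne_zero] at h3

/-- A compact plane set carrying logarithms does not separate the plane. -/
theorem HasLogs.isPreconnected_compl {E : Set ℂ} (hE : IsCompact E) (hl : HasLogs E) :
    IsPreconnected Eᶜ := by
  obtain ⟨ρ, hρ, hEρ⟩ := hE.isBounded.subset_closedBall_lt 0 0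
  have hext : {v : ℂ | ρ < ‖v‖} ⊆ Eᶜ := fun v hv hvE ↦ by
    have := hEρ hvE
    simp at this hv
    linarith
  have hR : ((ρ + 1 : ℝ) : ℂ) ∈ {v : ℂ | ρ < ‖v‖} := by
    simp only [mem_ofPred_eq, Complex.norm_real, Real.norm_eq_abs]
    exact (lt_add_one ρ).trans_le (le_abs_self _)
  refine isPreconnected_of_forall ((ρ + 1 : ℝ) : ℂ) fun x hx ↦ ?_
  set C := connectedComponentIn Eᶜ x with hC
  have hxC : x ∈ C := mem_connectedComponentIn hx
  by_cases hCR : ∃ v ∈ C, ρ < ‖v‖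
  · obtain ⟨v, hvC, hv⟩ := hCR
    refine ⟨C, connectedComponentIn_subset _ _, ?_, hxC, isPreconnected_connectedComponentIn⟩
    rw [hC, connectedComponentIn_eq hvC]
    exact (isPreconnected_lt_norm ρ).subset_connectedComponentIn hv hext hR
  exfalso
  push Not at hCR
  have hCo : IsOpen C := hE.isClosed.isOpen_compl.connectedComponentIn
  have hfr : ∀ y ∈ frontier C, y ∈ E := by
    intro y hy
    by_contra hyE
    rw [hCo.frontier_eq] at hy
    have hn : connectedComponentIn Eᶜ y ∈ 𝓝 y :=
      connectedComponentIn_mem_nhds (hE.isClosed.isOpen_compl.mem_nhds hyE)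
    obtain ⟨w, hw, hwC⟩ := mem_closure_iff_nhds.1 hy.1 _ hn
    apply hy.2
    rw [hC, connectedComponentIn_eq hwC, ← connectedComponentIn_eq hw]
    exact mem_connectedComponentIn hyE
  obtain ⟨φ, hφ⟩ := hl ⟨fun e ↦ e - x, by fun_prop⟩ fun e he ↦ hx (by
    rw [← sub_eq_zero.1 he]; exact e.2)
  obtain ⟨Φ, hΦ⟩ := ContinuousMap.exists_extension hE.isClosed.isClosedEmbedding_subtypeVal φ
  classical
  have hGc : Continuous fun y ↦ if y ∈ C then Complex.exp (Φ y) else y - x := by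
    refine Continuous.if (fun y hy ↦ ?_) (by fun_prop) (by fun_prop)
    have h1 : Φ y = φ ⟨y, hfr y hy⟩ := DFunLike.congr_fun hΦ ⟨y, hfr y hy⟩
    rw [h1, hφ]
    rfl
  obtain ⟨ψ, hψ⟩ := HasLogs.of_simplyConnected (X := ℂ) ⟨_, hGc⟩ (fun y ↦ by
    by_cases hy : y ∈ C
    · simp [hy]
    · simpa [hy, sub_eq_zero] using fun h : y = x ↦ hy (h ▸ hxC))
  refine not_exists_log_of_eq_sub x (ρ + ρ + 1) (by positivity) ψ ψ.continuous fun y hy ↦ ?_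
  rw [hψ]
  have : y ∉ C := fun hyC ↦ by
    have h1 := hCR y hyC
    have h2 := hCR x hxC
    have := norm_sub_le y x
    linarith
  simp [this]

theorem log_div_of_re_pos {p q : ℂ} (hp : 0 < p.re) (hq : 0 < q.re) :
    Complex.log (p / q) = Complex.log p - Complex.log q := by
  have hp0 : p ≠ 0 := by rintro rfl; simp at hp
  have hq0 : q ≠ 0 := by rintro rfl; simp at hq
  have h1 := abs_lt.1 (Complex.abs_arg_lt_pi_div_two_iff.2 (Or.inl hp))
  have h2 := abs_lt.1 (Complex.abs_arg_lt_pi_div_two_iff.2 (Or.inl hq))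
  rw [← Complex.log_exp (x := Complex.log p - Complex.log q), Complex.exp_sub,
    Complex.exp_log hp0, Complex.exp_log hq0]
  · simp only [Complex.sub_im, Complex.log_im]; linarith
  · simp only [Complex.sub_im, Complex.log_im]; linarith

theorem re_one_add_pos {w : ℂ} (hw : ‖w‖ < 1) : 0 < (1 + w).re := by
  have := (abs_le.1 (Complex.abs_re_le_norm w)).1
  simp only [Complex.add_re, Complex.one_re]
  linarith

/-- The points of `E` are farther from `v` than `v'` is. -/
def Near (E : Set ℂ) (v v' : ℂ) : Prop := ∀ e ∈ E, ‖v' - v‖ < ‖v - e‖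

/-- The increment of `log (· - e)` along the segment from `v` towards `v'`. -/
noncomputable def segLog {E : Set ℂ} {v v' : ℂ} (h : Near E v v') : C(I × E, ℂ) where
  toFun p := Complex.log (1 + (p.1 : ℝ) * ((v' - v) / (v - p.2)))
  continuous_toFun := by
    refine Continuous.clog ?_ fun p ↦ ?_
    · refine continuous_const.add (Continuous.mul (by fun_prop) ?_)
      refine Continuous.div (by fun_prop) (by fun_prop) fun p hp ↦ ?_
      have := h p.2 p.2.2
      rw [hp, norm_zero] at this
      exact absurd this (not_lt.2 (norm_nonneg _))
    · refine Or.inl (re_one_add_pos ?_)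
      have := h p.2 p.2.2
      rw [norm_mul, norm_div, Complex.norm_real, Real.norm_of_nonneg p.1.2.1]
      have h2 : ‖v' - v‖ / ‖v - p.2‖ < 1 :=
        (div_lt_one ((norm_nonneg _).trans_lt this)).2 this
      nlinarith [p.1.2.1, p.1.2.2, div_nonneg (norm_nonneg (v' - v)) (norm_nonneg (v - p.2))]

theorem exp_segLog {E : Set ℂ} {v v' : ℂ} (h : Near E v v') (t : I) (e : E) :
    Complex.exp (segLog h (t, e)) = (v + (t : ℝ) * (v' - v) - e) / (v - e) := by
  have h1 := h e e.2
  have h2 : 0 < ‖v - e‖ := (norm_nonneg _).trans_lt h1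
  have h0 : v - e ≠ 0 := norm_pos_iff.1 h2
  have h3 : ‖((t : ℝ) : ℂ) * ((v' - v) / (v - e))‖ < 1 := by
    rw [norm_mul, norm_div, Complex.norm_real, Real.norm_of_nonneg t.2.1]
    have h2 : ‖v' - v‖ / ‖v - e‖ < 1 := (div_lt_one h2).2 h1
    nlinarith [t.2.1, t.2.2, div_nonneg (norm_nonneg (v' - v)) (norm_nonneg (v - e))]
  change Complex.exp (Complex.log (1 + (t : ℝ) * ((v' - v) / (v - e)))) = _
  rw [Complex.exp_log]
  · field_simp
    ring
  · intro h4
    have := re_one_add_pos h3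
    rw [h4] at this
    simp at this

open Classical in
/-- The increment of `log (· - e)` from `v` to `v'`, as a function of `e ∈ E`. -/
noncomputable def logInc (E : Set ℂ) (v v' : ℂ) : C(E, ℂ) :=
  if h : Near E v v' then (segLog h).curry 1 else 0

theorem logInc_apply {E : Set ℂ} {v v' : ℂ} (h : Near E v v') (e : E) :
    logInc E v v' e = Complex.log ((v' - e) / (v - e)) := by
  have h2 : 0 < ‖v - e‖ := (norm_nonneg _).trans_lt (h e e.2)
  have h0 : v - e ≠ 0 := norm_pos_iff.1 h2
  rw [logInc, dif_pos h]
  change Complex.log (1 + ((1 : I) : ℝ) * ((v' - v) / (v - e))) = _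
  congr 1
  simp
  field_simp
  ring

theorem Near.re_div_pos {E : Set ℂ} {v v' : ℂ} (h : Near E v v') (e : E) :
    0 < ((v' - e) / (v - e)).re := by
  have h2 : 0 < ‖v - e‖ := (norm_nonneg _).trans_lt (h e e.2)
  have h0 : v - e ≠ 0 := norm_pos_iff.1 h2
  have : (v' - e) / (v - e) = 1 + (v' - v) / (v - e) := by field_simp; ring
  rw [this]
  apply re_one_add_pos
  rw [norm_div, div_lt_one h2]
  exact h e e.2

theorem logInc_add {E : Set ℂ} {v₁ v₂ v₃ : ℂ} (h₁₂ : Near E v₁ v₂) (h₂₃ : Near E v₂ v₃)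
    (h₁₃ : Near E v₁ v₃) : logInc E v₁ v₂ + logInc E v₂ v₃ = logInc E v₁ v₃ := by
  ext e
  have h1 : v₁ - e ≠ 0 := norm_pos_iff.1 ((norm_nonneg _).trans_lt (h₁₂ e e.2))
  have h2 : v₂ - e ≠ 0 := norm_pos_iff.1 ((norm_nonneg _).trans_lt (h₂₃ e e.2))
  have := log_div_of_re_pos (h₁₃.re_div_pos e) (h₁₂.re_div_pos e)
  rw [div_div_div_cancel_right₀ h1] at this
  rw [ContinuousMap.add_apply, logInc_apply h₁₂, logInc_apply h₂₃, logInc_apply h₁₃, this]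
  ring

/-- Points `v` of the plane with logarithms of `v - e` for `e` in `A` and in `B`. -/
def LogSpace (A B : Set ℂ) : Set (ℂ × C(A, ℂ) × C(B, ℂ)) :=
  {p | (∀ e : A, Complex.exp (p.2.1 e) = p.1 - e) ∧ ∀ e : B, Complex.exp (p.2.2 e) = p.1 - e}

theorem joinedIn_of_near {A B : Set ℂ} {v v' : ℂ} {a : C(A, ℂ)} {b : C(B, ℂ)}
    (h : (v, a, b) ∈ LogSpace A B) (hA : Near A v v') (hB : Near B v v') :
    JoinedIn (LogSpace A B) (v, a, b) (v', a + logInc A v v', b + logInc B v v') := by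
  have h0 : ∀ {E : Set ℂ} (hE : Near E v v'), (segLog hE).curry 0 = 0 := fun hE ↦ by
    ext e
    change Complex.log (1 + ((0 : I) : ℝ) * ((v' - v) / (v - e))) = 0
    simp
  have key : ∀ {E : Set ℂ} (hE : Near E v v') (φ : C(E, ℂ)),
      (∀ e : E, Complex.exp (φ e) = v - e) → ∀ (t : I) (e : E),
      Complex.exp ((φ + (segLog hE).curry t) e) = v + (t : ℝ) * (v' - v) - e := by
    intro E hE φ hφ t e
    have h1 : v - e ≠ 0 := norm_pos_iff.1 ((norm_nonneg _).trans_lt (hE e e.2))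
    rw [ContinuousMap.add_apply, Complex.exp_add, hφ, ContinuousMap.curry_apply, exp_segLog]
    field_simp
  refine ⟨⟨⟨fun t : I ↦ (v + (t : ℝ) * (v' - v), a + (segLog hA).curry t,
    b + (segLog hB).curry t), by fun_prop⟩, ?_, ?_⟩, fun t ↦ ⟨key hA a h.1 t, key hB b h.2 t⟩⟩
  · simp [h0]
  · simp [logInc, dif_pos hA, dif_pos hB]

/-- A locally defined additive cocycle on the plane is a coboundary on bounded sets. -/
theorem exists_eq_sub_of_cocycle {Q : Type*} [AddCommGroup Q] (d : ℂ → ℂ → Q) {δ : ℝ} (hδ : 0 < δ)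
    (hd : ∀ v₁ v₂ v₃, dist v₁ v₂ < δ → dist v₂ v₃ < δ → dist v₁ v₃ < δ →
      d v₁ v₂ + d v₂ v₃ = d v₁ v₃) (ρ : ℝ) :
    ∃ F : ℂ → Q, ∀ v v', ‖v‖ ≤ ρ → ‖v'‖ ≤ ρ → dist v v' < δ / 2 → d v v' = F v' - F v := by
  obtain ⟨N, hN⟩ := exists_nat_gt (ρ / (δ / 2))
  let c : ℕ → ℂ := fun k ↦ (k : ℂ) / (N : ℂ)
  refine ⟨fun v ↦ ∑ k ∈ Finset.range N, d (c k * v) (c (k + 1) * v), fun v v' hv hv' hvv ↦ ?_⟩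
  have hρ : 0 ≤ ρ := (norm_nonneg _).trans hv
  have hN0 : (0 : ℝ) < N := lt_of_le_of_lt (by positivity) hN
  have hstep : ∀ (k : ℕ) (u : ℂ), ‖u‖ ≤ ρ → dist (c k * u) (c (k + 1) * u) < δ / 2 := by
    intro k u hu
    have : c k * u - c (k + 1) * u = -(u / N) := by simp only [c]; push_cast; ring
    rw [dist_eq_norm, this, norm_neg, norm_div, Complex.norm_natCast, div_lt_iff₀ hN0]
    rw [div_lt_iff₀ (by positivity)] at hN
    linarith
  have hside : ∀ k ≤ N, dist (c k * v) (c k * v') < δ / 2 := by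
    intro k hk
    have h1 : ‖c k‖ ≤ 1 := by
      simp only [c, norm_div, Complex.norm_natCast]
      exact div_le_one_of_le₀ (by exact_mod_cast hk) hN0.le
    rw [dist_eq_norm, ← mul_sub, norm_mul, ← dist_eq_norm]
    exact (mul_le_of_le_one_left dist_nonneg h1).trans_lt hvv
  have hsum : ∀ n ≤ N, ∑ k ∈ Finset.range n, d (c k * v) (c (k + 1) * v) + d (c n * v) (c n * v') =
      ∑ k ∈ Finset.range n, d (c k * v') (c (k + 1) * v') := by
    intro n
    induction n with
    | zero =>
      intro _
      have := hd 0 0 0 (by simpa) (by simpa) (by simpa)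
      simpa [c] using this
    | succ k ih =>
      intro hk
      have h1 := hstep k v hv
      have h2 := hstep k v' hv'
      have h3 := hside k (by omega)
      have h4 := hside (k + 1) hk
      have h5 := (dist_triangle _ _ _).trans_lt (add_lt_add h3 h2)
      rw [add_halves] at h5
      rw [Finset.sum_range_succ, Finset.sum_range_succ, ← ih (by omega), add_assoc, add_assoc,
        hd _ _ _ (by linarith) (by linarith) h5, hd _ _ _ (by linarith) (by linarith) h5]
  have := hsum N le_rfl
  have hc : c N = 1 := div_self (by exact_mod_cast hN0.ne')
  rw [hc, one_mul, one_mul] at this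
  exact eq_sub_of_add_eq' this

theorem LogSpace.translate {A B : Set ℂ} {v : ℂ} {a n : C(A, ℂ)} {b m : C(B, ℂ)}
    (hn : ∀ e, Complex.exp (n e) = 1) (hm : ∀ e, Complex.exp (m e) = 1)
    (h : (v, a, b) ∈ LogSpace A B) : (v, a + n, b + m) ∈ LogSpace A B :=
  ⟨fun e ↦ by simpa [Complex.exp_add, hn] using h.1 e,
    fun e ↦ by simpa [Complex.exp_add, hm] using h.2 e⟩

theorem joinedIn_translate {A B : Set ℂ} {v v' : ℂ} {a a' n : C(A, ℂ)} {b b' m : C(B, ℂ)}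
    (hn : ∀ e, Complex.exp (n e) = 1) (hm : ∀ e, Complex.exp (m e) = 1)
    (h : JoinedIn (LogSpace A B) (v, a, b) (v', a', b')) :
    JoinedIn (LogSpace A B) (v, a + n, b + m) (v', a' + n, b' + m) := by
  obtain ⟨γ, hγ⟩ := h
  refine ⟨⟨⟨fun t ↦ ((γ t).1, (γ t).2.1 + n, (γ t).2.2 + m), by fun_prop⟩, by simp, by simp⟩,
    fun t ↦ LogSpace.translate hn hm (hγ t)⟩

/-- The changes of logarithms realised by loops based at `(v, a, b)`. -/
def monodromy {A B : Set ℂ} {v : ℂ} {a : C(A, ℂ)} {b : C(B, ℂ)} (h : (v, a, b) ∈ LogSpace A B) :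
    AddSubgroup (C(A, ℂ) × C(B, ℂ)) where
  carrier := {p | (∀ e, Complex.exp (p.1 e) = 1) ∧ (∀ e, Complex.exp (p.2 e) = 1) ∧
    JoinedIn (LogSpace A B) (v, a, b) (v, a + p.1, b + p.2)}
  zero_mem' := ⟨by simp, by simp, by simpa using JoinedIn.refl h⟩
  add_mem' := by
    rintro p q ⟨hp, hp', hpj⟩ ⟨hq, hq', hqj⟩
    refine ⟨by simp [Complex.exp_add, hp, hq], by simp [Complex.exp_add, hp', hq'], ?_⟩
    have := hqj.trans (joinedIn_translate hq hq' hpj)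
    simpa [add_assoc, add_comm q.1, add_comm q.2] using this
  neg_mem' := by
    rintro p ⟨hp, hp', hpj⟩
    have hn : ∀ e, Complex.exp ((-p.1) e) = 1 := by simp [Complex.exp_neg, hp]
    have hn' : ∀ e, Complex.exp ((-p.2) e) = 1 := by simp [Complex.exp_neg, hp']
    refine ⟨hn, hn', ?_⟩
    simpa using (joinedIn_translate hn hn' hpj).symm

theorem near_of_notMem_thickening {E : Set ℂ} {δ : ℝ} {v v₁ v₂ : ℂ}
    (hv : v ∉ Metric.thickening δ E) (h₁ : dist v v₁ < δ / 2) (h₂ : dist v₁ v₂ < δ / 2) :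
    Near E v₁ v₂ := by
  intro e he
  have h3 : δ ≤ dist v e := not_lt.1 fun h ↦ hv (Metric.mem_thickening_iff.2 ⟨e, he, h⟩)
  have h4 := dist_triangle v v₁ e
  rw [← dist_eq_norm, ← dist_eq_norm, dist_comm v₂]
  linarith

theorem exists_near_nhds {E : Set ℂ} (hE : IsClosed E) {v : ℂ} (hv : v ∉ E) :
    ∀ᶠ v' in 𝓝 v, Near E v v' ∧ Near E v' v := by
  obtain ⟨r, hr, hrE⟩ := Metric.isOpen_iff.1 hE.isOpen_compl v hv
  filter_upwards [Metric.ball_mem_nhds v (half_pos hr)] with v' hv'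
  have hv'' : v ∉ Metric.thickening r E := fun h ↦ by
    obtain ⟨e, he, h⟩ := Metric.mem_thickening_iff.1 h
    exact hrE (by rwa [Metric.mem_ball, dist_comm]) he
  rw [Metric.mem_ball] at hv'
  exact ⟨near_of_notMem_thickening hv'' (by simpa) (by rwa [dist_comm]),
    near_of_notMem_thickening hv'' (by rwa [dist_comm]) hv'⟩

/-- If the complement of `A ∪ B` is connected, every point of it is reached from the base point. -/
theorem exists_joinedIn {A B : Set ℂ} (hA : IsClosed A) (hB : IsClosed B)
    (hX : IsPreconnected (A ∪ B)ᶜ) {v v' : ℂ} {a : C(A, ℂ)} {b : C(B, ℂ)}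
    (h : (v, a, b) ∈ LogSpace A B) (hv : v ∈ (A ∪ B)ᶜ) (hv' : v' ∈ (A ∪ B)ᶜ) :
    ∃ p, JoinedIn (LogSpace A B) (v, a, b) (v', p) := by
  refine hX.induction₂' (fun v v' ↦ ∀ p, (v, p) ∈ LogSpace A B →
    ∃ q, JoinedIn (LogSpace A B) (v, p) (v', q)) ?_ ?_ hv hv' (a, b) h
  · intro x hx
    filter_upwards [mem_nhdsWithin_of_mem_nhds (exists_near_nhds hA fun h ↦ hx (Or.inl h)),
      mem_nhdsWithin_of_mem_nhds (exists_near_nhds hB fun h ↦ hx (Or.inr h))] with y hyA hyB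
    exact ⟨fun p hp ↦ ⟨_, joinedIn_of_near hp hyA.1 hyB.1⟩,
      fun p hp ↦ ⟨_, joinedIn_of_near hp hyA.2 hyB.2⟩⟩
  · intro x y z _ _ _ hxy hyz p hp
    obtain ⟨q, hq⟩ := hxy p hp
    obtain ⟨r, hr⟩ := hyz q hq.target_mem
    exact ⟨r, hq.trans hr⟩

/-- Summing logarithmic increments along a fine regular polygon around `e` yields `2πi`. -/
theorem sum_logInc_circle {A : Set ℂ} {R : ℝ} (hR : 0 < R) (hRA : ∀ e ∈ A, 2 * ‖e‖ ≤ R) {M : ℕ}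
    (hM : 7 ≤ M) (u : ℕ → ℂ)
    (hu : ∀ k, u k = R * Complex.exp ((k : ℂ) / M * (2 * Real.pi * Complex.I)))
    (hn : ∀ k, Near A (u k) (u (k + 1))) :
    ∑ k ∈ Finset.range M, logInc A (u k) (u (k + 1)) =
      ContinuousMap.const A (2 * Real.pi * Complex.I) := by
  ext e
  have hM0 : (M : ℂ) ≠ 0 := by exact_mod_cast (by omega : M ≠ 0)
  have hR0 : (R : ℂ) ≠ 0 := by exact_mod_cast hR.ne'
  have hunorm : ∀ k, ‖u k‖ = R := by
    intro k
    have : (k : ℂ) / M * (2 * Real.pi * Complex.I) =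
      ((k / M * (2 * Real.pi) : ℝ) : ℂ) * Complex.I := by push_cast; ring
    rw [hu, this, norm_mul, Complex.norm_exp_ofReal_mul_I, mul_one, Complex.norm_real,
      Real.norm_of_nonneg hR.le]
  have hu0 : ∀ k, u k ≠ 0 := fun k ↦ norm_pos_iff.1 (by rw [hunorm]; exact hR)
  have hhalf : ∀ k, ‖-(e / u k)‖ ≤ 1 / 2 := by
    intro k
    rw [norm_neg, norm_div, hunorm, div_le_iff₀ hR]
    linarith [hRA e e.2]
  let ψ : ℕ → ℂ := fun k ↦ (k : ℂ) / M * (2 * Real.pi * Complex.I) + Complex.log (1 + -(e / u k))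
  have hne : ∀ k, 1 + -(e / u k) ≠ 0 := fun k h ↦ by
    have := re_one_add_pos ((hhalf k).trans_lt (by norm_num))
    rw [h] at this
    simp at this
  have hψ : ∀ k, Complex.exp (ψ k) = (u k - e) / R := by
    intro k
    have h1 := hne k
    simp only [ψ]
    rw [Complex.exp_add, Complex.exp_log h1, eq_div_iff hR0, mul_right_comm, mul_comm _ (R : ℂ),
      ← hu]
    field_simp [hu0 k]
    ring
  have hlog : ∀ k, ‖Complex.log (1 + -(e / u k))‖ ≤ 3 / 4 := fun k ↦
    (Complex.norm_log_one_add_half_le_self (hhalf k)).trans (by linarith [hhalf k])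
  have hinc : ∀ k, logInc A (u k) (u (k + 1)) e = ψ (k + 1) - ψ k := by
    intro k
    have hd : ψ (k + 1) - ψ k = ((2 * Real.pi / M : ℝ) : ℂ) * Complex.I +
        (Complex.log (1 + -(e / u (k + 1))) - Complex.log (1 + -(e / u k))) := by
      simp only [ψ]; push_cast; ring
    have him : |(ψ (k + 1) - ψ k).im| < 3 := by
      refine (Complex.abs_im_le_norm _).trans_lt ?_
      rw [hd]
      have h1 := norm_sub_le (Complex.log (1 + -(e / u (k + 1)))) (Complex.log (1 + -(e / u k)))
      have h2 := hlog k
      have h3 := hlog (k + 1)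
      have h4 : ‖((2 * Real.pi / M : ℝ) : ℂ) * Complex.I‖ < 1 := by
        rw [norm_mul, Complex.norm_I, mul_one, Complex.norm_real,
          Real.norm_of_nonneg (by positivity)]
        have : (7 : ℝ) ≤ M := by exact_mod_cast hM
        rw [div_lt_one (by linarith)]
        linarith [Real.pi_lt_d2]
      refine (norm_add_le _ _).trans_lt ?_
      linarith
    have him' := abs_lt.1 him
    rw [logInc_apply (hn k), ← Complex.log_exp (x := ψ (k + 1) - ψ k)
      (by linarith [Real.pi_gt_three]) (by linarith [Real.pi_gt_three]), Complex.exp_sub, hψ, hψ,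
      div_div_div_cancel_right₀ hR0]
  rw [ContinuousMap.sum_apply, Finset.sum_congr rfl fun k _ ↦ hinc k, Finset.sum_range_sub]
  have h0 : u M = u 0 := by
    rw [hu, hu, div_self hM0, one_mul, Complex.exp_two_pi_mul_I]
    simp
  simp [ψ, h0, hM0]

/-- Some loop in the complement of `A ∪ B` winds once around `A` and does not wind around `B`. -/
theorem exists_loop {A B : Set ℂ} (hA : IsCompact A) (hB : IsCompact B) (hAB : Disjoint A B)
    (hX : IsPreconnected (A ∪ B)ᶜ) {R : ℝ} (hR : 0 < R)
    (hRA : ∀ e ∈ A, 2 * ‖e‖ ≤ R) (hRX : (R : ℂ) ∈ (A ∪ B)ᶜ) {a₀ : C(A, ℂ)} {b₀ : C(B, ℂ)}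
    (h : ((R : ℂ), a₀, b₀) ∈ LogSpace A B) :
    JoinedIn (LogSpace A B) (R, a₀, b₀)
      (R, a₀ + ContinuousMap.const A (2 * Real.pi * Complex.I), b₀) := by
  classical
  have hchoice : ∀ v : ℂ, ∃ p : C(A, ℂ) × C(B, ℂ),
      (v ∈ (A ∪ B)ᶜ → JoinedIn (LogSpace A B) (R, a₀, b₀) (v, p)) := by
    intro v
    by_cases hv : v ∈ (A ∪ B)ᶜ
    · obtain ⟨p, hp⟩ := exists_joinedIn hA.isClosed hB.isClosed hX h hRX hv
      exact ⟨p, fun _ ↦ hp⟩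
    · exact ⟨0, fun h ↦ absurd h hv⟩
  choose p hp using hchoice
  let Q := (C(A, ℂ) × C(B, ℂ)) ⧸ monodromy h
  let dA : ℂ → ℂ → Q := fun v v' ↦
    QuotientAddGroup.mk ((p v).1 + logInc A v v' - (p v').1, 0)
  let dB : ℂ → ℂ → Q := fun v v' ↦
    QuotientAddGroup.mk (0, (p v).2 + logInc B v v' - (p v').2)
  have hd0 : ∀ v v', Near A v v' → Near B v v' → v' ∉ A → v' ∉ B → dA v v' = - dB v v' := by
    intro v v' hvA hvB hA' hB'
    have hv : v ∈ (A ∪ B)ᶜ := by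
      rintro (hv | hv)
      · have := hvA v hv
        simp only [sub_self, norm_zero] at this
        exact absurd this (not_lt.2 (norm_nonneg _))
      · have := hvB v hv
        simp only [sub_self, norm_zero] at this
        exact absurd this (not_lt.2 (norm_nonneg _))
    have hv' : v' ∈ (A ∪ B)ᶜ := fun h ↦ h.elim hA' hB'
    have h1 := hp v hv
    have h2 := hp v' hv'
    have h3 := joinedIn_of_near (a := (p v).1) (b := (p v).2) h1.target_mem hvA hvB
    set n := (p v).1 + logInc A v v' - (p v').1 with hn
    set m := (p v).2 + logInc B v v' - (p v').2 with hm
    have hn1 : ∀ e, Complex.exp (n e) = 1 := fun e ↦ by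
      have h4 : Complex.exp (((p v).1 + logInc A v v') e) = v' - e := h3.target_mem.1 e
      have h5 : Complex.exp ((p v').1 e) = v' - e := h2.target_mem.1 e
      rw [hn, ContinuousMap.sub_apply, Complex.exp_sub, h4, h5, div_self]
      rw [← h5]
      exact Complex.exp_ne_zero _
    have hm1 : ∀ e, Complex.exp (m e) = 1 := fun e ↦ by
      have h4 : Complex.exp (((p v).2 + logInc B v v') e) = v' - e := h3.target_mem.2 e
      have h5 : Complex.exp ((p v').2 e) = v' - e := h2.target_mem.2 e
      rw [hm, ContinuousMap.sub_apply, Complex.exp_sub, h4, h5, div_self]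
      rw [← h5]
      exact Complex.exp_ne_zero _
    have h6 := joinedIn_translate (a' := (p v').1) (b' := (p v').2) hn1 hm1 h2
    have h7 : (p v').1 + n = (p v).1 + logInc A v v' := by rw [hn]; abel
    have h8 : (p v').2 + m = (p v).2 + logInc B v v' := by rw [hm]; abel
    rw [h7, h8] at h6
    have hmem : (n, m) ∈ monodromy h := ⟨hn1, hm1, (h1.trans h3).trans h6.symm⟩
    have h9 : ((QuotientAddGroup.mk (n, m) : Q)) = 0 :=
      (QuotientAddGroup.eq_zero_iff _).2 hmem
    rw [eq_neg_iff_add_eq_zero, ← h9]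
    change (QuotientAddGroup.mk ((n, (0 : C(B, ℂ))) + ((0 : C(A, ℂ)), m)) : Q) = _
    simp
  have hdA : ∀ v₁ v₂ v₃, Near A v₁ v₂ → Near A v₂ v₃ → Near A v₁ v₃ →
      dA v₁ v₂ + dA v₂ v₃ = dA v₁ v₃ := by
    intro v₁ v₂ v₃ h₁₂ h₂₃ h₁₃
    simp only [dA]
    rw [← QuotientAddGroup.mk_add, ← logInc_add h₁₂ h₂₃ h₁₃, Prod.mk_add_mk, add_zero]
    congr 2
    abel
  have hdB : ∀ v₁ v₂ v₃, Near B v₁ v₂ → Near B v₂ v₃ → Near B v₁ v₃ →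
      dB v₁ v₂ + dB v₂ v₃ = dB v₁ v₃ := by
    intro v₁ v₂ v₃ h₁₂ h₂₃ h₁₃
    simp only [dB]
    rw [← QuotientAddGroup.mk_add, ← logInc_add h₁₂ h₂₃ h₁₃, Prod.mk_add_mk, add_zero]
    congr 2
    abel
  let d : ℂ → ℂ → Q := fun v v' ↦ if Near A v v' ∧ v' ∉ A then dA v v' else - dB v v'
  have hdeqA : ∀ v v', Near A v v' → v' ∉ A → d v v' = dA v v' := fun v v' h1 h2 ↦
    if_pos ⟨h1, h2⟩
  have hdeqB : ∀ v v', Near B v v' → v' ∉ B → d v v' = - dB v v' := by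
    intro v v' h1 h2
    by_cases h3 : Near A v v' ∧ v' ∉ A
    · rw [hdeqA _ _ h3.1 h3.2, hd0 _ _ h3.1 h1 h3.2 h2]
    · exact if_neg h3
  obtain ⟨δ, hδ, hdisj⟩ := hAB.exists_thickenings hA hB.isClosed
  have hcoc : ∀ v₁ v₂ v₃, dist v₁ v₂ < δ / 2 → dist v₂ v₃ < δ / 2 → dist v₁ v₃ < δ / 2 →
      d v₁ v₂ + d v₂ v₃ = d v₁ v₃ := by
    intro v₁ v₂ v₃ h₁₂ h₂₃ h₁₃
    have hnot : ∀ {E : Set ℂ}, v₁ ∉ Metric.thickening δ E → v₂ ∉ E ∧ v₃ ∉ E := fun hE ↦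
      ⟨fun h ↦ hE (Metric.mem_thickening_iff.2 ⟨_, h, by linarith⟩),
        fun h ↦ hE (Metric.mem_thickening_iff.2 ⟨_, h, by linarith⟩)⟩
    have h0 : dist v₁ v₁ < δ / 2 := by rw [dist_self]; positivity
    by_cases hv : v₁ ∈ Metric.thickening δ A
    · have hvB := disjoint_left.1 hdisj hv
      have n₁₂ := near_of_notMem_thickening hvB h0 h₁₂
      have n₂₃ := near_of_notMem_thickening hvB h₁₂ h₂₃
      have n₁₃ := near_of_notMem_thickening hvB h0 h₁₃
      rw [hdeqB _ _ n₁₂ (hnot hvB).1, hdeqB _ _ n₂₃ (hnot hvB).2, hdeqB _ _ n₁₃ (hnot hvB).2,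
        ← hdB _ _ _ n₁₂ n₂₃ n₁₃]
      exact (neg_add _ _).symm
    · have n₁₂ := near_of_notMem_thickening hv h0 h₁₂
      have n₂₃ := near_of_notMem_thickening hv h₁₂ h₂₃
      have n₁₃ := near_of_notMem_thickening hv h0 h₁₃
      rw [hdeqA _ _ n₁₂ (hnot hv).1, hdeqA _ _ n₂₃ (hnot hv).2, hdeqA _ _ n₁₃ (hnot hv).2,
        hdA _ _ _ n₁₂ n₂₃ n₁₃]
  obtain ⟨F, hF⟩ := exists_eq_sub_of_cocycle d (half_pos hδ) hcoc R
  obtain ⟨M, hM⟩ := exists_nat_gt (max 7 (R * (2 * Real.pi) / min (δ / 2 / 2) (R / 2)))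
  have hM7 : 7 < M := by exact_mod_cast (le_max_left _ _).trans_lt hM
  have hM0 : (0 : ℝ) < M := by exact_mod_cast (by omega : 0 < M)
  have hMs := (le_max_right _ _).trans_lt hM
  let u : ℕ → ℂ := fun k ↦ R * Complex.exp ((k : ℂ) / M * (2 * Real.pi * Complex.I))
  have hunorm : ∀ k, ‖u k‖ = R := by
    intro k
    have : (k : ℂ) / M * (2 * Real.pi * Complex.I) =
      ((k / M * (2 * Real.pi) : ℝ) : ℂ) * Complex.I := by push_cast; ring
    simp only [u]
    rw [this, norm_mul, Complex.norm_exp_ofReal_mul_I, mul_one, Complex.norm_real,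
      Real.norm_of_nonneg hR.le]
  have hstep : ∀ k, ‖u (k + 1) - u k‖ < min (δ / 2 / 2) (R / 2) := by
    intro k
    have h1 : u (k + 1) - u k =
        u k * (Complex.exp (Complex.I * ((2 * Real.pi / M : ℝ) : ℂ)) - 1) := by
      simp only [u]
      rw [mul_sub, mul_one, mul_assoc (R : ℂ) (Complex.exp _), ← Complex.exp_add]
      congr 3
      push_cast
      ring
    rw [h1, norm_mul, hunorm]
    have h2 := Real.norm_exp_I_mul_ofReal_sub_one_le (x := 2 * Real.pi / M)
    rw [Real.norm_of_nonneg (by positivity)] at h2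
    refine (mul_le_mul_of_nonneg_left h2 hR.le).trans_lt ?_
    rw [div_lt_iff₀ (by positivity)] at hMs
    rw [← mul_div_assoc, div_lt_iff₀ hM0]
    linarith
  have hfar : ∀ k, ∀ e ∈ A, R / 2 ≤ ‖u k - e‖ := by
    intro k e he
    have h1 := norm_sub_norm_le (u k) e
    rw [hunorm] at h1
    linarith [hRA e he]
  have hnear : ∀ k, Near A (u k) (u (k + 1)) := fun k e he ↦
    ((hstep k).trans_le (min_le_right _ _)).trans_le (hfar k e he)
  have hnotA : ∀ k, u k ∉ A := fun k hk ↦ by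
    have := hfar k _ hk
    rw [sub_self, norm_zero] at this
    linarith
  have hper : u M = u 0 := by
    simp only [u]
    rw [div_self (by exact_mod_cast hM0.ne'), one_mul, Complex.exp_two_pi_mul_I]
    simp
  have hsum : ∑ k ∈ Finset.range M, dA (u k) (u (k + 1)) = 0 := by
    have h1 : ∀ k, dA (u k) (u (k + 1)) = F (u (k + 1)) - F (u k) := by
      intro k
      rw [← hdeqA _ _ (hnear k) (hnotA _)]
      refine hF _ _ (hunorm _).le (hunorm _).le ?_
      rw [dist_comm, dist_eq_norm]
      exact (hstep k).trans_le (min_le_left _ _)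
    rw [Finset.sum_congr rfl fun k _ ↦ h1 k, Finset.sum_range_sub (fun k ↦ F (u k)), hper, sub_self]
  have hsum' : ∀ K : ℕ, ∑ k ∈ Finset.range K, dA (u k) (u (k + 1)) =
      QuotientAddGroup.mk ((p (u 0)).1 + ∑ k ∈ Finset.range K, logInc A (u k) (u (k + 1)) -
        (p (u K)).1, 0) := by
    intro K
    induction K with
    | zero => simp [← Prod.zero_eq_mk]
    | succ K ih =>
      rw [Finset.sum_range_succ, ih, Finset.sum_range_succ]
      simp only [dA]
      rw [← QuotientAddGroup.mk_add, Prod.mk_add_mk, add_zero]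
      congr 2
      abel
  rw [hsum' M, hper, add_sub_cancel_left,
    sum_logInc_circle hR hRA hM7.le u (fun _ ↦ rfl) hnear] at hsum
  have := ((QuotientAddGroup.eq_zero_iff _).1 hsum).2.2
  simpa using this

theorem HasLogs.image {Z : Set ℝ} (hZ : IsCompact Z) {ζ : ℝ → ℂ} (hζ : Continuous ζ)
    (hi : InjOn ζ Z) : HasLogs (ζ '' Z) := by
  have : CompactSpace Z := isCompact_iff_compactSpace.1 hZ
  let e : Z ≃ ζ '' Z := Equiv.Set.imageOfInjOn ζ Z hi
  have he : Continuous e := Continuous.subtype_mk (hζ.comp continuous_subtype_val) _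
  exact (HasLogs.of_isCompact_real hZ).of_homeomorph he.homeoOfEquivCompactToT2

/-- The climbing time from height `c` to height `c + ε`. -/
noncomputable def climb (c ε : ℝ) (x : ℝ) : I := projIcc 0 1 zero_le_one ((x - c) / ε)

theorem continuous_climb (c ε : ℝ) : Continuous (climb c ε) :=
  continuous_projIcc.comp (by fun_prop)

theorem climb_of_le {c ε x : ℝ} (hε : 0 < ε) (hx : x ≤ c) : climb c ε x = 0 :=
  projIcc_of_le_left _ (div_nonpos_of_nonpos_of_nonneg (by linarith) hε.le)

theorem climb_of_ge {c ε x : ℝ} (hε : 0 < ε) (hx : c + ε ≤ x) : climb c ε x = 1 :=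
  projIcc_of_right_le _ ((one_le_div hε).2 (by linarith))

/-- Along an arc, logarithms on the level set `z = c` extend to a logarithm on the whole arc,
provided the loop `γ` is traversed fast enough. -/
theorem exists_log_on_arc {s t : ℝ} (hst : s ≤ t) {ζ : ℝ → ℂ} {z : ℝ → ℝ} (hζ : Continuous ζ)
    (hz : Continuous z) {c R : ℝ} (hR : ∀ θ ∈ Icc s t, 0 < ((R : ℂ) - ζ θ).re) {γ : C(I, ℂ)}
    (hγ0 : γ 0 = R) (hγ1 : γ 1 = R) {E : Set ℂ} (hE : IsCompact E)
    (hζE : ∀ θ ∈ Icc s t, z θ = c → ζ θ ∈ E)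
    {φ : C(I, C(E, ℂ))} (hφ : ∀ τ e, Complex.exp (φ τ e) = γ τ - e) {n : ℂ}
    (hn : Complex.exp n = 1) (hφ0 : ∀ e, φ 0 e = Complex.log (R - e))
    (hφ1 : ∀ e, φ 1 e = Complex.log (R - e) + n) :
    ∃ ε₀ > 0, ∀ ε, 0 < ε → ε ≤ ε₀ → ∃ Λ : ℝ → ℂ, Continuous Λ ∧
      (∀ θ ∈ Icc s t, Complex.exp (Λ θ) = γ (climb c ε (z θ)) - ζ θ) ∧
      (∀ θ ∈ Icc s t, z θ ≤ c → Λ θ = Complex.log (R - ζ θ)) ∧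
      (∀ θ ∈ Icc s t, c + ε ≤ z θ → Λ θ = Complex.log (R - ζ θ) + n) ∧
      (∀ θ ≤ s, Λ θ = Λ s) ∧ ∀ θ, t ≤ θ → Λ θ = Λ t := by
  have : CompactSpace E := isCompact_iff_compactSpace.1 hE
  let T := Icc s t
  have hne : ∀ θ : T, (R : ℂ) - ζ θ ≠ 0 := fun θ h ↦ by
    have := hR θ θ.2
    rw [h] at this
    simp at this
  let ℓ : C(T, ℂ) := ⟨fun θ ↦ Complex.log (R - ζ θ),
    Continuous.clog (by fun_prop) fun θ ↦ Or.inl (hR θ θ.2)⟩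
  have hℓ : ∀ θ, Complex.exp (ℓ θ) = R - ζ θ := fun θ ↦ Complex.exp_log (hne θ)
  let D : Set (T × I) := {p | z p.1 = c}
  have hD : IsClosed D := isClosed_eq (by fun_prop) (by fun_prop)
  let q₀ : C(D, ℂ) := ⟨fun p ↦ φ p.1.2 ⟨ζ p.1.1, hζE _ p.1.1.2 p.2⟩ - ℓ p.1.1, by
    refine Continuous.sub ?_ (by fun_prop)
    exact continuous_eval.comp ((φ.continuous.comp (by fun_prop)).prodMk
      (Continuous.subtype_mk (by fun_prop) _))⟩
  obtain ⟨q, hq⟩ := ContinuousMap.exists_extension hD.isClosedEmbedding_subtypeVal q₀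
  replace hq : ∀ (θ : T) (τ : I) (h : z θ = c), q (θ, τ) = φ τ ⟨ζ θ, hζE _ θ.2 h⟩ - ℓ θ :=
    fun θ τ h ↦ DFunLike.congr_fun hq ⟨(θ, τ), h⟩
  let ψ : C(T × I, ℂ) := ⟨fun p ↦ ℓ p.1 + (q p - (1 - (p.2 : ℝ)) * q (p.1, 0) -
    (p.2 : ℝ) * (q (p.1, 1) - n)), by fun_prop⟩
  have hψ0 : ∀ θ, ψ (θ, 0) = ℓ θ := fun θ ↦ by simp [ψ]
  have hψ1 : ∀ θ, ψ (θ, 1) = ℓ θ + n := fun θ ↦ by simp [ψ]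
  have hψc : ∀ (θ : T) (τ : I), z θ = c → Complex.exp (ψ (θ, τ)) = γ τ - ζ θ := by
    intro θ τ h
    have h0 : q (θ, 0) = 0 := by rw [hq θ 0 h, hφ0, sub_eq_zero]; rfl
    have h1 : q (θ, 1) = n := by rw [hq θ 1 h, hφ1, sub_eq_iff_eq_add']; rfl
    have h2 : ψ (θ, τ) = φ τ ⟨ζ θ, hζE _ θ.2 h⟩ := by simp [ψ, h0, h1, hq θ τ h]
    rw [h2, hφ]
  let W : Set (T × I) := {p | ‖Complex.exp (ψ p) - (γ p.2 - ζ p.1)‖ < ‖γ p.2 - ζ p.1‖}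
  have hWo : IsOpen W := isOpen_lt (by fun_prop) (by fun_prop)
  have hW : ∀ p, Complex.exp (ψ p) = γ p.2 - ζ p.1 → p ∈ W := by
    intro p h
    change ‖_‖ < ‖_‖
    rw [h, sub_self, norm_zero, norm_pos_iff, ← h]
    exact Complex.exp_ne_zero _
  obtain ⟨ε₀, hε₀, hWε⟩ : ∃ ε₀ > 0, ∀ p : T × I, |z p.1 - c| ≤ ε₀ → p ∈ W := by
    rcases (Wᶜ).eq_empty_or_nonempty with h | h
    · exact ⟨1, one_pos, fun p _ ↦ by_contra fun hp ↦ (h ▸ hp : p ∈ (∅ : Set (T × I)))⟩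
    · obtain ⟨p, hp, hmin⟩ := hWo.isClosed_compl.isCompact.exists_isMinOn h
        (f := fun p : T × I ↦ |z p.1 - c|) (by fun_prop)
      have hpos : 0 < |z p.1 - c| := abs_pos.2 fun h0 ↦
        hp (hW _ (hψc p.1 p.2 (sub_eq_zero.1 h0)))
      refine ⟨|z p.1 - c| / 2, half_pos hpos, fun p' hp' ↦ by_contra fun h' ↦ ?_⟩
      have : |z p.1 - c| ≤ |z p'.1 - c| := hmin h'
      linarith
  refine ⟨ε₀, hε₀, fun ε hε hεε ↦ ?_⟩
  let κ : C(T, T × I) := ⟨fun θ ↦ (θ, climb c ε (z θ)),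
    continuous_id.prodMk ((continuous_climb c ε).comp (by fun_prop))⟩
  have hlow : ∀ θ : T, z θ ≤ c → ψ (κ θ) = ℓ θ ∧ Complex.exp (ψ (κ θ)) = γ (κ θ).2 - ζ θ := by
    intro θ h
    have : κ θ = (θ, 0) := Prod.ext rfl (climb_of_le hε h)
    rw [this, hψ0]
    exact ⟨rfl, by rw [hℓ, hγ0]⟩
  have hhigh : ∀ θ : T, c + ε ≤ z θ →
      ψ (κ θ) = ℓ θ + n ∧ Complex.exp (ψ (κ θ)) = γ (κ θ).2 - ζ θ := by
    intro θ h
    have : κ θ = (θ, 1) := Prod.ext rfl (climb_of_ge hε h)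
    rw [this, hψ1]
    exact ⟨rfl, by rw [Complex.exp_add, hn, mul_one, hℓ, hγ1]⟩
  obtain ⟨Λ, hΛ, hΛψ⟩ := exists_log_of_norm_sub_lt
    ⟨fun θ : T ↦ γ (κ θ).2 - ζ θ, by fun_prop⟩ (ψ.comp κ) (fun θ ↦ by
      change κ θ ∈ W
      by_cases h1 : z θ ≤ c
      · exact hW _ (hlow θ h1).2
      by_cases h2 : c + ε ≤ z θ
      · exact hW _ (hhigh θ h2).2
      · exact hWε _ (abs_le.2 (by constructor <;> (change _ ≤ (_ : ℝ); simp [κ]; linarith))))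
  refine ⟨fun θ ↦ Λ (projIcc s t hst θ), by fun_prop, fun θ hθ ↦ ?_, fun θ hθ h ↦ ?_,
    fun θ hθ h ↦ ?_, fun θ hθ ↦ ?_, fun θ hθ ↦ ?_⟩
  · simp only [projIcc_of_mem hst hθ]
    exact hΛ ⟨θ, hθ⟩
  · simp only [projIcc_of_mem hst hθ]
    rw [hΛψ ⟨θ, hθ⟩ (hlow ⟨θ, hθ⟩ h).2]
    exact (hlow ⟨θ, hθ⟩ h).1
  · simp only [projIcc_of_mem hst hθ]
    rw [hΛψ ⟨θ, hθ⟩ (hhigh ⟨θ, hθ⟩ h).2]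
    exact (hhigh ⟨θ, hθ⟩ h).1
  · simp only [projIcc_of_le_left hst hθ, projIcc_left]
  · simp only [projIcc_of_right_le hst hθ, projIcc_right]

/-- A closed curve `(ζ, z)` that is injective and not horizontal winds once around a suitable
graph `{(g x, x)}`. -/
theorem exists_axis {ζ : ℝ → ℂ} {z : ℝ → ℝ} (hζ : Continuous ζ) (hz : Continuous z) {s q t : ℝ}
    (hsq : s ≤ q) (hqt : q ≤ t) (hζp : ζ t = ζ s) (hzp : z t = z s)
    (hinj : InjOn (fun θ ↦ (ζ θ, z θ)) (Ico s t)) (hlt : z s < z q) :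
    ∃ (g : ℝ → ℂ) (Λ : ℝ → ℂ), Continuous g ∧ Continuous Λ ∧
      (∀ θ ∈ Icc s t, Complex.exp (Λ θ) = g (z θ) - ζ θ) ∧
      Λ t = Λ s + 2 * Real.pi * Complex.I := by
  obtain ⟨c, hc, hcq⟩ := exists_between hlt
  let Z₁ := {θ ∈ Icc s q | z θ = c}
  let Z₂ := {θ ∈ Icc q t | z θ = c}
  have hZc : ∀ {a b : ℝ}, IsCompact {θ ∈ Icc a b | z θ = c} := fun {a b} ↦
    isCompact_Icc.inter_right (isClosed_eq hz continuous_const)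
  have hZsub : Z₁ ∪ Z₂ ⊆ Ico s t := by
    rintro θ (⟨h, hθ⟩ | ⟨h, hθ⟩)
    · refine ⟨h.1, (h.2.trans hqt).lt_of_ne ?_⟩
      rintro rfl
      linarith
    · refine ⟨hsq.trans h.1, h.2.lt_of_ne ?_⟩
      rintro rfl
      linarith
  have hζZ : InjOn ζ (Z₁ ∪ Z₂) := fun θ hθ θ' hθ' h ↦ hinj (hZsub hθ) (hZsub hθ') (by
    have h1 : z θ = c := hθ.elim (fun h ↦ h.2) fun h ↦ h.2
    have h2 : z θ' = c := hθ'.elim (fun h ↦ h.2) fun h ↦ h.2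
    simp [h, h1, h2])
  let A := ζ '' Z₁
  let B := ζ '' Z₂
  have hA : IsCompact A := hZc.image hζ
  have hB : IsCompact B := hZc.image hζ
  have hAB : Disjoint A B := by
    rw [disjoint_left]
    rintro _ ⟨θ, hθ, rfl⟩ ⟨θ', hθ', h⟩
    have h' := hζZ (Or.inr hθ') (Or.inl hθ) h
    subst h'
    have : θ' = q := le_antisymm hθ.1.2 hθ'.1.1
    subst this
    linarith [hθ.2]
  have hX : IsPreconnected (A ∪ B)ᶜ := by
    rw [← image_union]
    exact (HasLogs.image (hZc.union hZc) hζ hζZ).isPreconnected_compl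
      ((hZc.union hZc).image hζ)
  obtain ⟨r, hr, hrζ⟩ :=
    ((isCompact_Icc (a := s) (b := t)).image hζ).isBounded.subset_closedBall_lt 0 0
  replace hrζ : ∀ θ ∈ Icc s t, ‖ζ θ‖ ≤ r := fun θ hθ ↦ by
    simpa using hrζ (mem_image_of_mem ζ hθ)
  have hre : ∀ v : ℂ, ‖v‖ ≤ r → 0 < (((2 * r : ℝ) : ℂ) - v).re := fun v hv ↦ by
    have := (Complex.abs_re_le_norm v).trans hv
    rw [Complex.sub_re, Complex.ofReal_re]
    linarith [(abs_le.1 this).2]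
  have hAr : ∀ e ∈ A, ‖e‖ ≤ r := by
    rintro _ ⟨θ, hθ, rfl⟩
    exact hrζ θ ⟨hθ.1.1, hθ.1.2.trans hqt⟩
  have hBr : ∀ e ∈ B, ‖e‖ ≤ r := by
    rintro _ ⟨θ, hθ, rfl⟩
    exact hrζ θ ⟨hsq.trans hθ.1.1, hθ.1.2⟩
  have hne : ∀ v : ℂ, ‖v‖ ≤ r → ((2 * r : ℝ) : ℂ) - v ≠ 0 := fun v hv h ↦ by
    have := hre v hv
    rw [h] at this
    simp at this
  let ℓ : ∀ {E : Set ℂ}, (∀ e ∈ E, ‖e‖ ≤ r) → C(E, ℂ) := fun {E} hE ↦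
    ⟨fun e ↦ Complex.log (((2 * r : ℝ) : ℂ) - e),
      Continuous.clog (by fun_prop) fun e ↦ Or.inl (hre e (hE e e.2))⟩
  have hℓ : ∀ {E : Set ℂ} (hE : ∀ e ∈ E, ‖e‖ ≤ r) (e : E),
      Complex.exp (ℓ hE e) = ((2 * r : ℝ) : ℂ) - e := fun hE e ↦
    Complex.exp_log (hne e (hE e e.2))
  have hbase : (((2 * r : ℝ) : ℂ), ℓ hAr, ℓ hBr) ∈ LogSpace A B := ⟨hℓ hAr, hℓ hBr⟩
  obtain ⟨Γ, hΓ⟩ := exists_loop hA hB hAB hX (by positivity : 0 < 2 * r)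
    (fun e he ↦ by linarith [hAr e he])
    (fun h ↦ hne _ (h.elim (hAr _) (hBr _)) (sub_self _)) hbase
  let γ : C(I, ℂ) := ⟨fun τ ↦ (Γ τ).1, by fun_prop⟩
  have hγ0 : γ 0 = (2 * r : ℝ) := by change (Γ 0).1 = _; rw [Γ.source]
  have hγ1 : γ 1 = (2 * r : ℝ) := by change (Γ 1).1 = _; rw [Γ.target]
  obtain ⟨ε₁, hε₁, h₁⟩ := exists_log_on_arc hsq hζ hz
    (fun θ hθ ↦ hre _ (hrζ θ ⟨hθ.1, hθ.2.trans hqt⟩)) hγ0 hγ1 hA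
    (fun θ hθ h ↦ ⟨θ, ⟨hθ, h⟩, rfl⟩) (φ := ⟨fun τ ↦ (Γ τ).2.1, by fun_prop⟩)
    (fun τ ↦ (hΓ τ).1) Complex.exp_two_pi_mul_I
    (fun e ↦ by change (Γ 0).2.1 e = _; rw [Γ.source]; rfl)
    (fun e ↦ by change (Γ 1).2.1 e = _; rw [Γ.target]; rfl)
  obtain ⟨ε₂, hε₂, h₂⟩ := exists_log_on_arc hqt hζ hz
    (fun θ hθ ↦ hre _ (hrζ θ ⟨hsq.trans hθ.1, hθ.2⟩)) hγ0 hγ1 hB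
    (fun θ hθ h ↦ ⟨θ, ⟨hθ, h⟩, rfl⟩) (φ := ⟨fun τ ↦ (Γ τ).2.2, by fun_prop⟩)
    (fun τ ↦ (hΓ τ).2) Complex.exp_zero
    (fun e ↦ by change (Γ 0).2.2 e = _; rw [Γ.source]; rfl)
    (fun e ↦ by change (Γ 1).2.2 e = _; rw [Γ.target, add_zero]; rfl)
  have hε : 0 < min (min ε₁ ε₂) (z q - c) := lt_min (lt_min hε₁ hε₂) (sub_pos.2 hcq)
  set ε := min (min ε₁ ε₂) (z q - c) with hεdef
  have hεq : c + ε ≤ z q := by linarith [min_le_right (min ε₁ ε₂) (z q - c)]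
  obtain ⟨Λ₁, hΛ₁, hexp₁, hlow₁, hhigh₁, -, hright₁⟩ :=
    h₁ ε hε ((min_le_left _ _).trans (min_le_left _ _))
  obtain ⟨Λ₂, hΛ₂, hexp₂, hlow₂, hhigh₂, hleft₂, -⟩ :=
    h₂ ε hε ((min_le_left _ _).trans (min_le_right _ _))
  have hq₁ := hhigh₁ q ⟨hsq, le_rfl⟩ hεq
  have hq₂ := hhigh₂ q ⟨le_rfl, hqt⟩ hεq
  rw [add_zero] at hq₂
  refine ⟨fun x ↦ γ (climb c ε x), fun θ ↦ Λ₁ θ + Λ₂ θ - Λ₂ q,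
    γ.continuous.comp (continuous_climb c ε), by fun_prop, fun θ hθ ↦ ?_, ?_⟩
  · beta_reduce
    rcases le_total θ q with h | h
    · rw [hleft₂ θ h, add_sub_cancel_right]
      exact hexp₁ θ ⟨hθ.1, h⟩
    · rw [hright₁ θ h, hq₁, hq₂, add_right_comm, add_sub_right_comm, add_sub_cancel_left,
        add_comm, Complex.exp_add, Complex.exp_two_pi_mul_I, one_mul]
      exact hexp₂ θ ⟨h, hθ.2⟩
  · have hs := hlow₁ s ⟨le_rfl, hsq⟩ hc.le
    have ht := hlow₂ t ⟨hqt, le_rfl⟩ (by rw [hzp]; exact hc.le)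
    beta_reduce
    rw [hright₁ t hqt, hleft₂ s hsq, hs, ht, hq₁, hq₂, hζp]
    ring

/-- A knot that is not horizontal winds once around a suitable graph `{(g x, x)}`. -/
theorem exists_axis_circle {ζ : Circle → ℂ} {z : Circle → ℝ} (hζ : Continuous ζ)
    (hz : Continuous z) (hinj : Function.Injective fun w ↦ (ζ w, z w)) {p q : Circle}
    (hpq : z p < z q) :
    ∃ (g : ℝ → ℂ) (lam : C(Circle, ℂ)), Continuous g ∧
      ∀ w, ζ w - g (z w) = w * Complex.exp (lam w) := by
  set s := Complex.arg p with hs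
  have hsp : Circle.exp s = p := Circle.exp_arg p
  have hper : ∀ θ, Circle.exp (θ + 2 * Real.pi) = Circle.exp θ := fun θ ↦ by
    rw [Circle.exp_add, Circle.exp_two_pi, mul_one]
  have hsurj : ∀ w : Circle, ∃ θ ∈ Ico s (s + 2 * Real.pi), Circle.exp θ = w := fun w ↦ by
    refine ⟨toIcoMod Real.two_pi_pos s (Complex.arg w), toIcoMod_mem_Ico _ _ _, ?_⟩
    rw [toIcoMod, Circle.exp_eq_exp.2 ⟨-toIcoDiv Real.two_pi_pos s (Complex.arg w), _⟩,
      Circle.exp_arg w]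
    simp [sub_eq_add_neg]
  obtain ⟨θq, hθq, hq⟩ := hsurj q
  have hinjexp : ∀ θ ∈ Ico s (s + 2 * Real.pi), ∀ θ' ∈ Ico s (s + 2 * Real.pi),
      Circle.exp θ = Circle.exp θ' → θ = θ' := by
    intro θ hθ θ' hθ' h
    obtain ⟨m, hm⟩ := Circle.exp_eq_exp.1 h
    have h1 : (m : ℝ) < 1 := by nlinarith [hθ.1, hθ.2, hθ'.1, hθ'.2, Real.pi_pos]
    have h2 : (-1 : ℝ) < m := by nlinarith [hθ.1, hθ.2, hθ'.1, hθ'.2, Real.pi_pos]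
    have h3 : m < 1 := by exact_mod_cast h1
    have h4 : -1 < m := by exact_mod_cast h2
    have h5 : m = 0 := by omega
    simpa [h5] using hm
  obtain ⟨g, Λ, hg, hΛ, hexp, hΛp⟩ := exists_axis (ζ := fun θ ↦ ζ (Circle.exp θ))
    (z := fun θ ↦ z (Circle.exp θ)) (by fun_prop) (by fun_prop) hθq.1 hθq.2.le (by rw [hper])
    (by rw [hper]) (fun θ hθ θ' hθ' h ↦ hinjexp θ hθ θ' hθ' (hinj h)) (by rw [hsp, hq]; exact hpq)
  let T := Icc s (s + 2 * Real.pi)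
  let e : C(T, Circle) := ⟨fun θ ↦ Circle.exp θ, by fun_prop⟩
  have he : IsQuotientMap e := e.continuous.isClosedMap.isQuotientMap e.continuous fun w ↦ by
    obtain ⟨θ, hθ, h⟩ := hsurj w
    exact ⟨⟨θ, Ico_subset_Icc_self hθ⟩, h⟩
  let m : C(T, ℂ) := ⟨fun θ ↦ Λ θ - (θ : ℝ) * Complex.I + Real.pi * Complex.I, by fun_prop⟩
  have hm : ∀ θ θ' : T, e θ = e θ' → m θ = m θ' := by
    have hend : ∀ θ : T, (θ : ℝ) ∈ Ico s (s + 2 * Real.pi) ∨ (θ : ℝ) = s + 2 * Real.pi :=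
      fun θ ↦ by
        rcases θ.2.2.lt_or_eq with h | h
        · exact Or.inl ⟨θ.2.1, h⟩
        · exact Or.inr h
    have hfirst : ∀ θ : T, ∃ θ₁ : T, (θ₁ : ℝ) ∈ Ico s (s + 2 * Real.pi) ∧ e θ₁ = e θ ∧
        m θ₁ = m θ := by
      intro θ
      rcases hend θ with h | h
      · exact ⟨θ, h, rfl, rfl⟩
      · have hs0 : s < s + 2 * Real.pi := by linarith [Real.pi_pos]
        refine ⟨⟨s, le_rfl, hs0.le⟩, ⟨le_rfl, hs0⟩, ?_, ?_⟩
        · change Circle.exp s = Circle.exp θ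
          rw [h, hper]
        · change Λ s - s * Complex.I + _ = Λ θ - (θ : ℝ) * Complex.I + _
          rw [h, hΛp]
          push_cast
          ring
    intro θ θ' h
    obtain ⟨θ₁, h₁, h₂, h₃⟩ := hfirst θ
    obtain ⟨θ₁', h₁', h₂', h₃'⟩ := hfirst θ'
    have : θ₁ = θ₁' := Subtype.ext (hinjexp _ h₁ _ h₁' ((h₂.trans h).trans h₂'.symm))
    rw [← h₃, ← h₃', this]
  refine ⟨g, he.lift m hm, hg, fun w ↦ ?_⟩
  obtain ⟨θ, rfl⟩ := he.surjective w
  have h1 : he.lift m hm (e θ) = m θ := DFunLike.congr_fun (he.lift_comp m hm) θ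
  have h2 := hexp θ θ.2
  rw [h1]
  change ζ (Circle.exp θ) - g (z (Circle.exp θ)) =
    (Circle.exp θ : ℂ) * Complex.exp (Λ θ - (θ : ℝ) * Complex.I + Real.pi * Complex.I)
  rw [Complex.exp_add, Complex.exp_sub, h2, Complex.exp_pi_mul_I, Circle.coe_exp,
    ← mul_assoc, mul_div_cancel₀ _ (Complex.exp_ne_zero _)]
  ring

/-- Two maps are `I`-equivalent if they cobound an embedded copy of `X × I` in `Y × I` that meets
the ends of `Y × I` only in its own ends. -/
def IEquiv {X Y : Type*} [TopologicalSpace X] [TopologicalSpace Y] (K₀ K₁ : X → Y) : Prop :=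
  ∃ F : X × I → Y × I, Continuous F ∧ Function.Injective F ∧
    (∀ x, F (x, 0) = (K₀ x, 0)) ∧ (∀ x, F (x, 1) = (K₁ x, 1)) ∧
    ∀ x t, ((F (x, t)).2 = 0 ∨ (F (x, t)).2 = 1) → (t = 0 ∨ t = 1)

section IEquiv
variable {X Y : Type*} [TopologicalSpace X] [TopologicalSpace Y] {K₀ K₁ K₂ : X → Y}

theorem IEquiv.of_isotopy (H : X × I → Y) (hH : Continuous H)
    (hinj : ∀ t, Function.Injective fun x ↦ H (x, t)) :
    IEquiv (fun x ↦ H (x, 0)) fun x ↦ H (x, 1) := by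
  refine ⟨fun p ↦ (H p, p.2), by fun_prop, ?_, fun _ ↦ rfl, fun _ ↦ rfl, fun _ _ h ↦ h⟩
  rintro ⟨x, t⟩ ⟨x', t'⟩ h
  obtain ⟨h₁, rfl : t = t'⟩ := Prod.mk.inj h
  rw [hinj t h₁]

theorem IEquiv.comp {X' Y' : Type*} [TopologicalSpace X'] [TopologicalSpace Y']
    (h : IEquiv K₀ K₁) (e : X' ≃ₜ X) (f : Y ≃ₜ Y') :
    IEquiv (f ∘ K₀ ∘ e) (f ∘ K₁ ∘ e) := by
  obtain ⟨F, hF, hinj, h₀, h₁, hl⟩ := h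
  refine ⟨fun p ↦ (f (F (e p.1, p.2)).1, (F (e p.1, p.2)).2), by fun_prop, ?_,
    fun x ↦ by simp [h₀], fun x ↦ by simp [h₁], fun x t h ↦ hl (e x) t h⟩
  rintro ⟨x, t⟩ ⟨x', t'⟩ h
  obtain ⟨h₁, h₂⟩ := Prod.mk.inj h
  obtain ⟨h₃, h₄⟩ := Prod.mk.inj (hinj (Prod.ext (f.injective h₁) h₂))
  exact Prod.ext (e.injective h₃) h₄

theorem IEquiv.trans (h : IEquiv K₀ K₁) (h' : IEquiv K₁ K₂) : IEquiv K₀ K₂ := by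
  obtain ⟨F, hF, hFi, hF₀, hF₁, hFl⟩ := h
  obtain ⟨G, hG, hGi, hG₀, hG₁, hGl⟩ := h'
  let a : I → I := fun t ↦ projIcc 0 1 zero_le_one (2 * (t : ℝ))
  let b : I → I := fun t ↦ projIcc 0 1 zero_le_one (2 * (t : ℝ) - 1)
  have ha : Continuous a := continuous_projIcc.comp (by fun_prop)
  have hb : Continuous b := continuous_projIcc.comp (by fun_prop)
  have ha' : ∀ t : I, (t : ℝ) ≤ 1 / 2 → (a t : ℝ) = 2 * t := fun t ht ↦ by
    simp only [a]
    rw [projIcc_of_mem zero_le_one ⟨by linarith [t.2.1], by linarith⟩]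
  have hb' : ∀ t : I, 1 / 2 ≤ (t : ℝ) → (b t : ℝ) = 2 * t - 1 := fun t ht ↦ by
    simp only [b]
    rw [projIcc_of_mem zero_le_one ⟨by linarith, by linarith [t.2.2]⟩]
  let lo : I → I := fun y ↦ ⟨(y : ℝ) / 2, by linarith [y.2.1], by linarith [y.2.2]⟩
  let hi : I → I := fun y ↦ ⟨(1 + (y : ℝ)) / 2, by linarith [y.2.1], by linarith [y.2.2]⟩
  have hlo : Continuous lo := by fun_prop
  have hhi : Continuous hi := by fun_prop
  let P : X × I → Y × I := fun p ↦ ((F (p.1, a p.2)).1, lo (F (p.1, a p.2)).2)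
  let Q : X × I → Y × I := fun p ↦ ((G (p.1, b p.2)).1, hi (G (p.1, b p.2)).2)
  -- interior levels of the two halves
  have hQ : ∀ x (t : I), 1 / 2 < (t : ℝ) → (0 : ℝ) < (G (x, b t)).2 := fun x t ht ↦ by
    refine (G (x, b t)).2.2.1.lt_of_ne' fun h ↦ ?_
    rcases hGl x (b t) (Or.inl (Subtype.ext h)) with h0 | h1
    · have := congr_arg Subtype.val h0
      rw [hb' t ht.le] at this
      simp at this
      linarith
    · rw [h1, hG₁] at h
      simp at h
  have hP : ∀ x (t : I), (t : ℝ) ≤ 1 / 2 → ((F (x, a t)).2 : ℝ) = 0 → t = 0 := fun x t ht h ↦ by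
    rcases hFl x (a t) (Or.inl (Subtype.ext h)) with h0 | h1
    · have := congr_arg Subtype.val h0
      rw [ha' t ht] at this
      refine Subtype.ext ?_
      simp at this ⊢
      exact this
    · rw [h1, hF₁] at h
      simp at h
  have hQ1 : ∀ x (t : I), 1 / 2 < (t : ℝ) → ((G (x, b t)).2 : ℝ) = 1 → t = 1 := fun x t ht h ↦ by
    rcases hGl x (b t) (Or.inr (Subtype.ext h)) with h0 | h1
    · rw [h0, hG₀] at h
      simp at h
    · have := congr_arg Subtype.val h1
      rw [hb' t ht.le, Icc.coe_one] at this
      refine Subtype.ext ?_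
      rw [Icc.coe_one]
      linarith
  have hcross : ∀ x x' (t t' : I), (t : ℝ) ≤ 1 / 2 → 1 / 2 < (t' : ℝ) → P (x, t) ≠ Q (x', t') := by
    intro x x' t t' ht ht' h
    have h2 : ((F (x, a t)).2 : ℝ) / 2 = (1 + ((G (x', b t')).2 : ℝ)) / 2 :=
      congr_arg (fun y ↦ ((Prod.snd y : I) : ℝ)) h
    linarith [hQ x' t' ht', (F (x, a t)).2.2.2]
  refine ⟨fun p ↦ if (p.2 : ℝ) ≤ 1 / 2 then P p else Q p, ?_, ?_, fun x ↦ ?_, fun x ↦ ?_, ?_⟩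
  · refine Continuous.if_le (by fun_prop) (by fun_prop) (by fun_prop) continuous_const ?_
    rintro ⟨x, t⟩ (ht : (t : ℝ) = 1 / 2)
    have h1 : a t = 1 := Subtype.ext (by rw [ha' t ht.le, ht]; norm_num)
    have h0 : b t = 0 := Subtype.ext (by rw [hb' t ht.ge, ht]; norm_num)
    refine Prod.ext ?_ (Subtype.ext ?_)
    · simp only [P, Q, h1, h0, hF₁, hG₀]
    · simp only [P, Q, h1, h0, hF₁, hG₀, lo, hi]
      simp
  · rintro ⟨x, t⟩ ⟨x', t'⟩ h
    dsimp only at h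
    split_ifs at h with h1 h2 h2
    · obtain ⟨h3, h4⟩ := Prod.mk.inj h
      have h5 : (F (x, a t)).2 = (F (x', a t')).2 := by
        refine Subtype.ext ?_
        have := congr_arg Subtype.val h4
        simp only [lo] at this
        linarith
      obtain ⟨h6, h7⟩ := Prod.mk.inj (hFi (Prod.ext h3 h5))
      refine Prod.ext h6 (Subtype.ext ?_)
      have := congr_arg Subtype.val h7
      rw [ha' t h1, ha' t' h2] at this
      dsimp only
      linarith
    · exact (hcross _ _ _ _ h1 (not_le.1 h2) h).elim
    · exact (hcross _ _ _ _ h2 (not_le.1 h1) h.symm).elim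
    · obtain ⟨h3, h4⟩ := Prod.mk.inj h
      have h5 : (G (x, b t)).2 = (G (x', b t')).2 := by
        refine Subtype.ext ?_
        have := congr_arg Subtype.val h4
        simp only [hi] at this
        linarith
      obtain ⟨h6, h7⟩ := Prod.mk.inj (hGi (Prod.ext h3 h5))
      refine Prod.ext h6 (Subtype.ext ?_)
      have := congr_arg Subtype.val h7
      rw [hb' t (not_le.1 h1).le, hb' t' (not_le.1 h2).le] at this
      dsimp only
      linarith
  · have h0 : a 0 = 0 := Subtype.ext (by rw [ha' 0 (by simp)]; simp)
    refine (if_pos (by simp)).trans ?_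
    refine Prod.ext ?_ (Subtype.ext ?_) <;> simp [P, h0, hF₀, lo]
  · have h1 : b 1 = 1 := Subtype.ext (by rw [hb' 1 (by norm_num)]; norm_num)
    refine (if_neg (by norm_num)).trans ?_
    refine Prod.ext ?_ (Subtype.ext ?_) <;> simp [Q, h1, hG₁, hi]
  · intro x t h
    dsimp only at h
    split_ifs at h with h1
    · rcases h with h | h <;> have h2 := congr_arg Subtype.val h <;>
        simp only [P, lo, Icc.coe_zero, Icc.coe_one] at h2
      · exact Or.inl (hP x t h1 (by linarith))
      · linarith [(F (x, a t)).2.2.2]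
    · rcases h with h | h <;> have h2 := congr_arg Subtype.val h <;>
        simp only [Q, hi, Icc.coe_zero, Icc.coe_one] at h2
      · linarith [(G (x, b t)).2.2.1]
      · exact Or.inr (hQ1 x t (not_le.1 h1) (by linarith))

end IEquiv

/-- The point of the circle at angle `C * u / (1 - u)` from `τ`; as `u → 1` it turns infinitely
often. -/
noncomputable def spiral (C : ℝ) (p : Circle × I) : Circle :=
  p.1 * Circle.exp (C * ((p.2 : ℝ) / (1 - p.2)))

/-- The values of `f` along the spiral, damped at its end. -/
noncomputable def damped (C : ℝ) (f : Circle → ℝ) (p : Circle × I) : ℝ :=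
  (1 - (p.2 : ℝ)) * f (spiral C p)

theorem continuous_damped (C : ℝ) {f : Circle → ℝ} (hf : Continuous f) :
    Continuous (damped C f) := by
  obtain ⟨B, hB⟩ := isCompact_univ.exists_bound_of_continuousOn hf.continuousOn
  rw [continuous_iff_continuousAt]
  rintro p
  by_cases hp : (p.2 : ℝ) = 1
  · have h0 : damped C f p = 0 := by simp [damped, hp]
    rw [ContinuousAt, h0]
    have hlim : Tendsto (fun x : Circle × I ↦ (1 - (x.2 : ℝ)) * B) (𝓝 p) (𝓝 0) := by
      have : Continuous fun x : Circle × I ↦ (1 - (x.2 : ℝ)) * B := by fun_prop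
      simpa [hp] using this.tendsto p
    refine squeeze_zero_norm (fun x ↦ ?_) hlim
    rw [damped, norm_mul, Real.norm_of_nonneg (by linarith [x.2.2.2])]
    exact mul_le_mul_of_nonneg_left (hB _ (mem_univ _)) (by linarith [x.2.2.2])
  · have h1 : (1 - (p.2 : ℝ)) ≠ 0 := fun h ↦ hp (by linarith)
    have : ContinuousAt (spiral C) p := by
      unfold spiral
      refine continuous_fst.continuousAt.mul (Circle.exp.continuous.continuousAt.comp ?_)
      refine continuousAt_const.mul (ContinuousAt.div (by fun_prop) (by fun_prop) h1)
    exact ContinuousAt.mul (by fun_prop) (hf.continuousAt.comp this)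

/-- A closed curve of the form `(w * exp (lam w), z w)` is `I`-equivalent to the round circle:
push it to the end of the interval along a spiral while shrinking it towards the axis of the
covering `w * exp (i θ)`. -/
theorem IEquiv.of_exp (lam : C(Circle, ℂ)) {z : Circle → ℝ} (hz : Continuous z)
    (hinj : Function.Injective fun w : Circle ↦ ((w : ℂ) * Complex.exp (lam w), z w)) :
    IEquiv (fun w : Circle ↦ ((w : ℂ) * Complex.exp (lam w), z w))
      fun w : Circle ↦ ((w : ℂ), (0 : ℝ)) := by
  obtain ⟨C, hC⟩ : ∃ C, ∀ w, |(lam w).im| < C := by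
    obtain ⟨B, hB⟩ := isCompact_univ.exists_bound_of_continuousOn
      (f := fun w ↦ (lam w).im) (s := univ) (by fun_prop)
    exact ⟨B + 1, fun w ↦ (hB w (mem_univ w)).trans_lt (lt_add_one B)⟩
  have hC0 : 0 < C := (abs_nonneg _).trans_lt (hC 1)
  let aμ := damped C fun w ↦ (lam w).re
  let aν := damped C fun w ↦ (lam w).im
  let az := damped C z
  have haμ : Continuous aμ := continuous_damped C (by fun_prop)
  have haν : Continuous aν := continuous_damped C (by fun_prop)
  have haz : Continuous az := continuous_damped C hz
  let den : Circle × I → ℝ := fun p ↦ (1 - (p.2 : ℝ)) + (C * p.2 + p.2 * aν p)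
  have hdenc : Continuous den := by fun_prop
  have hbr : ∀ p : Circle × I, 0 < C + aν p := fun p ↦ by
    have h1 := abs_lt.1 (hC (spiral C p))
    have h2 := p.2.2.1
    have h3 := p.2.2.2
    simp only [aν, damped]
    nlinarith
  have hden : ∀ p, 0 < den p := fun p ↦ by
    have h1 := hbr p
    have h2 := p.2.2.1
    have h3 := p.2.2.2
    rcases h2.eq_or_lt with h | h
    · simp only [den, ← h]; norm_num
    · have := mul_pos h h1
      simp only [den]
      nlinarith
  have hnum : ∀ p : Circle × I, (p.2 : ℝ) * (C + aν p) = den p - (1 - p.2) := fun p ↦ by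
    simp only [den]; ring
  let ε : Circle × I → ℝ := fun p ↦ (1 - (p.2 : ℝ)) / den p
  have hεc : Continuous ε := Continuous.div (by fun_prop) hdenc fun p ↦ (hden p).ne'
  have hε0 : ∀ p, 0 ≤ ε p := fun p ↦ div_nonneg (by linarith [p.2.2.2]) (hden p).le
  have hε1 : ∀ p, ε p ≤ 1 := fun p ↦ by
    rw [div_le_one (hden p)]
    linarith [hnum p, mul_nonneg p.2.2.1 (hbr p).le]
  have hεz : ∀ p, ε p = 0 → p.2 = 1 := fun p h ↦ by
    rcases div_eq_zero_iff.1 h with h | h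
    · exact Subtype.ext (by rw [Icc.coe_one]; linarith)
    · exact absurd h (hden p).ne'
  have hεo : ∀ p, ε p = 1 → p.2 = 0 := fun p h ↦ by
    have h1 := (div_eq_one_iff_eq (hden p).ne').1 h
    have h2 := hnum p
    rw [h1, sub_self] at h2
    exact Subtype.ext ((mul_eq_zero.1 h2).resolve_right (hbr p).ne')
  let c : Circle × I → ℂ := fun p ↦ p.1 * Complex.exp (aν p * Complex.I + (aμ p / den p : ℝ))
  have hcc : Continuous c := by
    have : Continuous fun p ↦ aμ p / den p := haμ.div hdenc fun p ↦ (hden p).ne'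
    fun_prop
  refine ⟨fun p ↦ ((c p, az p / den p), ⟨1 - ε p, by linarith [hε1 p], by linarith [hε0 p]⟩),
    ?_, ?_, fun w ↦ ?_, fun w ↦ ?_, fun w u h ↦ ?_⟩
  · exact (hcc.prodMk (haz.div hdenc fun p ↦ (hden p).ne')).prodMk
      (Continuous.subtype_mk (by fun_prop) _)
  · intro p p' h
    obtain ⟨h1, h2⟩ := Prod.mk.inj h
    obtain ⟨hc, hzz⟩ := Prod.mk.inj h1
    have hεε : ε p = ε p' := by linarith [congr_arg Subtype.val h2]
    by_cases hu : ε p = 0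
    · have hp := hεz p hu
      have hp' := hεz p' (hεε ▸ hu)
      have hc1 : ∀ x : Circle × I, x.2 = 1 → c x = x.1 := fun x hx ↦ by
        simp [c, aν, aμ, damped, hx]
      rw [hc1 p hp, hc1 p' hp'] at hc
      exact Prod.ext (Circle.ext hc) (hp.trans hp'.symm)
    have hlt : ∀ x : Circle × I, ε x ≠ 0 → 0 < 1 - (x.2 : ℝ) := fun x hx ↦
      (sub_nonneg.2 x.2.2.2).lt_of_ne' fun h0 ↦ hx (by simp only [ε, h0, zero_div])
    have hu' : ε p' ≠ 0 := hεε ▸ hu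
    let θ : Circle × I → ℝ := fun x ↦ C * ((x.2 : ℝ) / (1 - x.2)) + x.2 * (lam (spiral C x)).im
    have hθ : ∀ x, ε x ≠ 0 → (ε x)⁻¹ = 1 + θ x := fun x hx ↦ by
      have h0 := (hlt x hx).ne'
      simp only [ε, θ, den, aν, damped, inv_div]
      field_simp
    have hθθ : θ p = θ p' := by
      have h3 := hθ p hu
      rw [hεε, hθ p' hu'] at h3
      linarith
    have hdiv : ∀ (f : Circle → ℝ) x, damped C f x / den x = ε x * f (spiral C x) := fun f x ↦ by
      simp only [damped, ε]
      ring
    have hcθ : ∀ x, c x * Complex.exp (θ x * Complex.I) = (spiral C x : ℂ) *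
        Complex.exp ((lam (spiral C x)).im * Complex.I +
          (ε x * (lam (spiral C x)).re : ℝ)) := fun x ↦ by
      simp only [c, aμ, hdiv]
      rw [mul_assoc, ← Complex.exp_add]
      simp only [spiral, Circle.coe_mul, Circle.coe_exp, mul_assoc, ← Complex.exp_add]
      congr 2
      simp only [θ, aν, damped, spiral]
      push_cast
      ring
    have hnorm : ∀ x, ‖c x‖ = Real.exp (ε x * (lam (spiral C x)).re) := fun x ↦ by
      simp only [c, aμ, hdiv]
      simp [Complex.norm_exp, Circle.norm_coe]
    have hre : (lam (spiral C p)).re = (lam (spiral C p')).re := by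
      have h3 := hnorm p
      rw [hc, hnorm p', Real.exp_eq_exp, hεε] at h3
      exact (mul_left_cancel₀ hu' h3).symm
    have hzw : z (spiral C p) = z (spiral C p') := by
      simp only [az, hdiv] at hzz
      rw [hεε] at hzz
      exact mul_left_cancel₀ hu' hzz
    have hsplit : ∀ x, (spiral C x : ℂ) * Complex.exp (lam (spiral C x)) =
        c x * Complex.exp (θ x * Complex.I) *
          Complex.exp ((1 - ε x) * (lam (spiral C x)).re : ℝ) := fun x ↦ by
      rw [hcθ, mul_assoc, ← Complex.exp_add]
      congr 2
      conv_lhs => rw [← Complex.re_add_im (lam (spiral C x))]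
      push_cast
      ring
    have hw : spiral C p = spiral C p' := hinj <| Prod.ext
      (by beta_reduce; rw [hsplit, hsplit, hc, hθθ, hre, hεε]) hzw
    have huu : (p.2 : ℝ) = p'.2 := by
      have h0 := hlt p hu
      have h0' := hlt p' hu'
      have h3 := abs_lt.1 (hC (spiral C p'))
      have h4 := hθθ
      simp only [θ, hw] at h4
      have h5 : (p.2 - p'.2 : ℝ) * (C + (1 - p.2) * (1 - p'.2) * (lam (spiral C p')).im) = 0 := by
        field_simp at h4
        linear_combination h4
      have h6 : 0 < C + (1 - p.2 : ℝ) * (1 - p'.2) * (lam (spiral C p')).im := by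
        have h7 : (1 - p.2 : ℝ) * (1 - p'.2) ≤ 1 :=
          mul_le_one₀ (by linarith [p.2.2.1]) h0'.le (by linarith [p'.2.2.1])
        nlinarith [mul_pos h0 h0']
      linarith [(mul_eq_zero.1 h5).resolve_right h6.ne']
    refine Prod.ext ?_ (Subtype.ext huu)
    simp only [spiral, huu] at hw
    exact mul_right_cancel hw
  · have hd : den (w, 0) = 1 := by simp [den]
    have hs : spiral C (w, 0) = w := by simp [spiral]
    refine Prod.ext (Prod.ext ?_ ?_) (Subtype.ext ?_)
    · simp only [c, aν, aμ, hd, damped, hs]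
      rw [← Complex.re_add_im (lam w)]
      simp [add_comm]
    · simp [az, hd, damped, hs]
    · simp [ε, hd]
  · refine Prod.ext (Prod.ext ?_ ?_) (Subtype.ext ?_) <;> simp [c, aν, aμ, az, ε, damped]
  · rcases h with h | h <;> have h' := congr_arg Subtype.val h <;>
      simp only [Icc.coe_zero, Icc.coe_one] at h'
    · exact Or.inl (hεo (w, u) (by linarith))
    · exact Or.inr (hεz (w, u) (by linarith))

/-- Every knot in `ℂ × ℝ` is `I`-equivalent to the round circle. -/
theorem IEquiv.of_injective {ζ : Circle → ℂ} {z : Circle → ℝ} (hζ : Continuous ζ)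
    (hz : Continuous z) (hinj : Function.Injective fun w ↦ (ζ w, z w)) :
    IEquiv (fun w ↦ (ζ w, z w)) fun w : Circle ↦ ((w : ℂ), (0 : ℝ)) := by
  have hne : (1 : Circle) ≠ -1 := fun h ↦ by
    have := congr_arg (fun w : Circle ↦ (w : ℂ).re) h
    norm_num at this
  -- tilt the knot so that it is not horizontal
  obtain ⟨ℓ, hℓ, hℓne⟩ : ∃ ℓ : ℂ → ℝ, Continuous ℓ ∧
      z 1 + ℓ (ζ 1) ≠ z (-1) + ℓ (ζ (-1)) := by
    by_cases h : z 1 = z (-1)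
    · by_cases hr : (ζ 1).re = (ζ (-1)).re
      · refine ⟨Complex.im, Complex.continuous_im, fun him ↦ hne (hinj (Prod.ext ?_ h))⟩
        rw [h] at him
        exact Complex.ext hr (add_left_cancel him)
      · exact ⟨Complex.re, Complex.continuous_re, fun h' ↦ hr (add_left_cancel (h ▸ h'))⟩
    · exact ⟨fun _ ↦ 0, continuous_const, by simpa using h⟩
  have hz' : Continuous fun w ↦ z w + ℓ (ζ w) := by fun_prop
  have hinj' : Function.Injective fun w ↦ (ζ w, z w + ℓ (ζ w)) := fun w w' h ↦ by
    obtain ⟨h₁, h₂⟩ := Prod.mk.inj h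
    rw [h₁] at h₂
    exact hinj (Prod.ext h₁ (add_right_cancel h₂))
  obtain ⟨p, q, hpq⟩ : ∃ p q, z p + ℓ (ζ p) < z q + ℓ (ζ q) :=
    hℓne.lt_or_gt.elim (fun h ↦ ⟨_, _, h⟩) fun h ↦ ⟨_, _, h⟩
  obtain ⟨g, lam, hg, hgl⟩ := exists_axis_circle hζ hz' hinj' hpq
  -- then straighten the axis
  have h₁ := IEquiv.of_isotopy (X := Circle) (Y := ℂ × ℝ)
    (fun p ↦ (ζ p.1 - (p.2 : ℝ) * g (z p.1 + (p.2 : ℝ) * ℓ (ζ p.1)),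
      z p.1 + (p.2 : ℝ) * ℓ (ζ p.1))) (by fun_prop) fun t w w' h ↦ by
        obtain ⟨h₁, h₂⟩ := Prod.mk.inj h
        rw [h₂] at h₁
        have h₃ := sub_left_injective h₁
        rw [h₃] at h₂
        exact hinj (Prod.ext h₃ (add_right_cancel h₂))
  simp only [Icc.coe_zero, Icc.coe_one, Complex.ofReal_zero, Complex.ofReal_one, zero_mul,
    one_mul, sub_zero, add_zero, hgl] at h₁
  refine h₁.trans (IEquiv.of_exp lam hz' fun w w' h ↦ hinj' ?_)
  obtain ⟨h₂, h₃⟩ := Prod.mk.inj h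
  rw [← hgl, ← hgl, h₃] at h₂
  exact Prod.ext (sub_left_injective h₂) h₃

/-- The unit circle of the Euclidean plane is the unit circle of `ℂ`. -/
noncomputable def circleHomeomorph : Circle1 ≃ₜ Circle where
  toFun x := ⟨⟨x.1 0, x.1 1⟩, mem_sphere_zero_iff_norm.2 <| by
    have h := x.2
    rw [EuclideanSpace.norm_eq] at h
    simpa [Complex.norm_eq_sqrt_sq_add_sq, Fin.sum_univ_two] using h⟩
  invFun w := ⟨!₂[(w : ℂ).re, (w : ℂ).im], by
    rw [← w.norm_coe, Complex.norm_eq_sqrt_sq_add_sq, EuclideanSpace.norm_eq]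
    simp [Fin.sum_univ_two]⟩
  left_inv x := by
    ext i
    fin_cases i <;> rfl
  right_inv w := rfl
  continuous_toFun := by
    refine Continuous.subtype_mk ?_ _
    have : Continuous fun x : Circle1 ↦ Complex.equivRealProdCLM.symm (x.1 0, x.1 1) := by
      fun_prop
    exact this
  continuous_invFun := by
    refine Continuous.subtype_mk ?_ _
    fun_prop

/-- Euclidean space as `ℂ × ℝ`. -/
noncomputable def spaceHomeomorph : ℂ × ℝ ≃ₜ R3 where
  toFun p := !₂[p.1.re, p.1.im, p.2]
  invFun x := (⟨x 0, x 1⟩, x 2)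
  left_inv p := rfl
  right_inv x := by
    ext i
    fin_cases i <;> rfl
  continuous_toFun := by fun_prop
  continuous_invFun := by
    have : Continuous fun x : R3 ↦ (Complex.equivRealProdCLM.symm (x 0, x 1), x 2) := by
      fun_prop
    exact this

end GiffenKnot

/-- Giffen's theorem: every knot, possibly wild, is `I`-equivalent to the unknot. -/
theorem every_knot_I_equivalent_to_unknot
    (K : Circle1 → R3) (hKc : Continuous K) (hKi : Function.Injective K) :
    ∃ F : Circle1 × I01 → R3 × I01, Continuous F ∧ Function.Injective F ∧
      (∀ x, F (x, i0) = (K x, i0)) ∧ (∀ x, F (x, i1) = (unknot x, i1)) ∧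
      ∀ x t, ((F (x, t)).2 = i0 ∨ (F (x, t)).2 = i1) → (t = i0 ∨ t = i1) := by
  have h := (GiffenKnot.IEquiv.of_injective
    (ζ := fun w ↦ (GiffenKnot.spaceHomeomorph.symm
      (K (GiffenKnot.circleHomeomorph.symm w))).1)
    (z := fun w ↦ (GiffenKnot.spaceHomeomorph.symm
      (K (GiffenKnot.circleHomeomorph.symm w))).2) (by fun_prop) (by fun_prop)
    fun w w' h ↦ GiffenKnot.circleHomeomorph.symm.injective
      (hKi (GiffenKnot.spaceHomeomorph.symm.injective h))).comp
    GiffenKnot.circleHomeomorph GiffenKnot.spaceHomeomorph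
  obtain ⟨F, hF, hinj, h₀, h₁, hl⟩ := h
  refine ⟨F, hF, hinj, fun x ↦ (h₀ x).trans ?_, fun x ↦ (h₁ x).trans ?_, hl⟩
  · simp [i0]
  · refine Prod.ext ?_ rfl
    ext i
    fin_cases i <;> rfl
end

section
/- There exist only countably many isotopy classes of PL links: there is a countable set S of 2-component polygonal links such that every 2-component polygonal link is isotopic to some member of S. -/
/-- A set is polygonal if it is a finite union of straight line segments. -/
def IsPolygonal (A : Set R3) : Prop :=
  ∃ S : Finset (R3 × R3), A = ⋃ p ∈ S, segment ℝ p.1 p.2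

/-- Two 2-component links are isotopic if they are homotopic through injective maps. -/
def Isotopic (L₀ L₁ : Circle1 × Fin 2 → R3) : Prop :=
  ∃ H : (Circle1 × Fin 2) × I01 → R3, Continuous H ∧
    (∀ x, H (x, i0) = L₀ x) ∧ (∀ x, H (x, i1) = L₁ x) ∧
    ∀ t : I01, Function.Injective (fun x => H (x, t))

open Set Filter Topology

section PolygonalLinks

variable {E : Type*} [NormedAddCommGroup E] [InnerProductSpace ℝ E]

/-- The tent function supported on `[-1, 1]` with peak value `1` at the origin. -/
def hat (u : ℝ) : ℝ := max 0 (1 - max u (-u))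

theorem continuous_hat : Continuous hat := by
  unfold hat; fun_prop

theorem hat_of_one_le {u : ℝ} (h : 1 ≤ u) : hat u = 0 :=
  max_eq_left (by linarith [le_max_left u (-u)])

theorem hat_of_le_neg_one {u : ℝ} (h : u ≤ -1) : hat u = 0 :=
  max_eq_left (by linarith [le_max_right u (-u)])

theorem hat_of_mem_Icc {u : ℝ} (h₀ : 0 ≤ u) (h₁ : u ≤ 1) : hat u = 1 - u := by
  rw [hat, max_eq_left (by linarith : -u ≤ u), max_eq_right (by linarith)]

theorem hat_of_mem_Icc_neg {u : ℝ} (h₀ : -1 ≤ u) (h₁ : u ≤ 0) : hat u = 1 + u := by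
  rw [hat, max_eq_right (by linarith : u ≤ -u), max_eq_right (by linarith)]; ring

/-- The polygonal path with vertices `v 0, …, v n`, at parameter `u ∈ [0, n]`. -/
noncomputable def polyline (n : ℕ) (v : ℕ → E) (u : ℝ) : E :=
  ∑ k ∈ Finset.range (n + 1), hat (u - k) • v k

theorem polyline_succ (n : ℕ) (v : ℕ → E) (u : ℝ) :
    polyline (n + 1) v u = polyline n v u + hat (u - (n + 1 : ℕ)) • v (n + 1) :=
  Finset.sum_range_succ _ _

theorem polyline_congr {n : ℕ} {v v' : ℕ → E} (h : ∀ k ≤ n, v k = v' k) (u : ℝ) :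
    polyline n v u = polyline n v' u :=
  Finset.sum_congr rfl fun k hk => by rw [h k (by simpa [Nat.lt_succ_iff] using hk)]

theorem polyline_last_add (n : ℕ) (v : ℕ → E) {a : ℝ} (h₀ : 0 ≤ a) (h₁ : a ≤ 1) :
    polyline n v (n + a) = (1 - a) • v n := by
  rw [polyline, Finset.sum_range_succ, Finset.sum_eq_zero, zero_add, add_sub_cancel_left,
    hat_of_mem_Icc h₀ h₁]
  intro k hk
  have : (k : ℝ) + 1 ≤ n := by exact_mod_cast Finset.mem_range.1 hk
  rw [hat_of_one_le (by linarith), zero_smul]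

theorem polyline_natCast_add {n j : ℕ} (hj : j < n) (v : ℕ → E) {a : ℝ} (h₀ : 0 ≤ a)
    (h₁ : a ≤ 1) : polyline n v (j + a) = (1 - a) • v j + a • v (j + 1) := by
  induction n with
  | zero => omega
  | succ n ih =>
    rw [polyline_succ]
    rcases (Nat.lt_succ_iff.1 hj).lt_or_eq with h | rfl
    · have : (j : ℝ) + 1 ≤ n := by exact_mod_cast h
      rw [ih h, hat_of_le_neg_one (by push_cast; linarith), zero_smul, add_zero]
    · rw [polyline_last_add j v h₀ h₁, hat_of_mem_Icc_neg] <;> push_cast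
      · congr 2; ring
      · linarith
      · linarith

theorem polyline_natCast (n : ℕ) (v : ℕ → E) : polyline n v n = v n := by
  simpa using polyline_last_add n v le_rfl zero_le_one

theorem polyline_zero (n : ℕ) (v : ℕ → E) : polyline n v 0 = v 0 := by
  rcases n.eq_zero_or_pos with rfl | h
  · simpa using polyline_natCast 0 v
  · simpa using polyline_natCast_add h v le_rfl zero_le_one

theorem polyline_image (n : ℕ) (hn : 0 < n) (v : ℕ → E) :
    polyline n v '' Icc 0 n = ⋃ j ∈ Finset.range n, segment ℝ (v j) (v (j + 1)) := by
  ext z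
  simp only [mem_image, mem_iUnion, Finset.mem_range, exists_prop]
  constructor
  · rintro ⟨u, ⟨h0, h1⟩, rfl⟩
    obtain ⟨j, hj, ha, hb⟩ : ∃ j < n, (j : ℝ) ≤ u ∧ u ≤ j + 1 := by
      rcases h1.lt_or_eq with h | rfl
      · exact ⟨⌊u⌋₊, (Nat.floor_lt h0).2 h, Nat.floor_le h0, (Nat.lt_floor_add_one u).le⟩
      · exact ⟨n - 1, by omega, by simp, by rw [Nat.cast_pred hn]; simp⟩
    refine ⟨j, hj, 1 - (u - j), u - j, by linarith, by linarith, by ring, ?_⟩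
    rw [← polyline_natCast_add hj v (by linarith) (by linarith), add_sub_cancel]
  · rintro ⟨j, hj, a, b, ha, hb, hab, rfl⟩
    have : (j : ℝ) + 1 ≤ n := by exact_mod_cast hj
    refine ⟨j + b, ⟨by positivity, by linarith⟩, ?_⟩
    rw [polyline_natCast_add hj v hb (by linarith), ← hab, add_sub_cancel_right]

/-- A real function which is affine near each point on each ray issuing from that point. -/
def RayAffine (f : ℝ → ℝ) : Prop :=
  ∀ u σ : ℝ, ∃ m : ℝ, ∀ᶠ h in 𝓝[≥] (0 : ℝ), f (u + σ * h) = f u + h * m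

theorem RayAffine.affine (a b : ℝ) : RayAffine fun s => a * s + b :=
  fun _ σ => ⟨a * σ, Eventually.of_forall fun _ => by ring⟩

theorem RayAffine.add {f g : ℝ → ℝ} (hf : RayAffine f) (hg : RayAffine g) :
    RayAffine fun s => f s + g s := fun u σ => by
  obtain ⟨m, hm⟩ := hf u σ
  obtain ⟨k, hk⟩ := hg u σ
  exact ⟨m + k, by filter_upwards [hm, hk] with h h₁ h₂; rw [h₁, h₂]; ring⟩

theorem RayAffine.neg {f : ℝ → ℝ} (hf : RayAffine f) : RayAffine fun s => -f s := fun u σ => by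
  obtain ⟨m, hm⟩ := hf u σ
  exact ⟨-m, by filter_upwards [hm] with h h₁; rw [h₁]; ring⟩

theorem RayAffine.comp_affine {f : ℝ → ℝ} (hf : RayAffine f) (a b : ℝ) :
    RayAffine fun s => f (a * s + b) := fun u σ => by
  obtain ⟨m, hm⟩ := hf (a * u + b) (a * σ)
  exact ⟨m, by filter_upwards [hm] with h h₁; rw [← h₁]; ring_nf⟩

theorem RayAffine.max {f g : ℝ → ℝ} (hf : RayAffine f) (hg : RayAffine g) :
    RayAffine fun s => max (f s) (g s) := fun u σ => by
  wlog hfg : f u < g u ∨ f u = g u generalizing f g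
  · obtain ⟨m, hm⟩ := this hg hf (Or.inl (by grind))
    exact ⟨m, by simpa only [max_comm] using hm⟩
  obtain ⟨m, hm⟩ := hf u σ
  obtain ⟨k, hk⟩ := hg u σ
  rcases hfg with hlt | heq
  · have hev : ∀ᶠ h in 𝓝[≥] (0 : ℝ), f u + h * m < g u + h * k := by
      refine (Tendsto.eventually_lt (y := f u) (z := g u) ?_ ?_ hlt).filter_mono
        nhdsWithin_le_nhds
      · exact Continuous.tendsto' (by fun_prop) _ _ (by simp)
      · exact Continuous.tendsto' (by fun_prop) _ _ (by simp)
    refine ⟨k, ?_⟩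
    filter_upwards [hm, hk, hev] with h h₁ h₂ h₃
    rw [h₁, h₂, max_eq_right h₃.le, max_eq_right hlt.le]
  · refine ⟨Max.max m k, ?_⟩
    filter_upwards [hm, hk, self_mem_nhdsWithin] with h h₁ h₂ (h₃ : 0 ≤ h)
    rw [h₁, h₂, heq, max_self, mul_max_of_nonneg _ _ h₃, max_add_add_left]

theorem rayAffine_hat : RayAffine hat := by
  have h := (RayAffine.affine 0 0).max
    ((RayAffine.affine 0 1).add ((RayAffine.affine 1 0).max (RayAffine.affine (-1) 0)).neg)
  convert h using 2 with u
  simp [hat, sub_eq_add_neg]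

theorem UnitAddCircle.eq_coe_Ico (x : UnitAddCircle) :
    ∃ s ∈ Ico (0 : ℝ) 1, (s : UnitAddCircle) = x :=
  AddCircle.eq_coe_Ico x

theorem UnitAddCircle.coe_injOn : InjOn ((↑) : ℝ → UnitAddCircle) (Ico 0 1) := fun x hx y hy h =>
  (AddCircle.coe_eq_coe_iff_of_mem_Ico (p := 1) (a := 0) (by simpa using hx)
    (by simpa using hy)).1 h

theorem AddCircle.liftIco_one_coe {B : Type*} {f : ℝ → B} (hf : f 0 = f 1) {s : ℝ}
    (hs : s ∈ Icc (0 : ℝ) 1) : AddCircle.liftIco 1 0 f s = f s := by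
  rcases hs.2.lt_or_eq with h | rfl
  · exact AddCircle.liftIco_zero_coe_apply ⟨hs.1, h⟩
  · rw [AddCircle.coe_period, ← hf, ← AddCircle.coe_zero,
      AddCircle.liftIco_zero_coe_apply ⟨le_rfl, one_pos⟩]

theorem RayAffine.liftIco {f : ℝ → ℝ} (hf : RayAffine f) (h01 : f 0 = f 1) (x : UnitAddCircle)
    {σ : ℝ} (hσ : σ = 1 ∨ σ = -1) :
    ∃ m : ℝ, ∀ᶠ h in 𝓝[≥] (0 : ℝ), AddCircle.liftIco 1 0 f (x + ((σ * h : ℝ) : UnitAddCircle)) =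
      AddCircle.liftIco 1 0 f x + h * m := by
  obtain ⟨s, hs, rfl⟩ : ∃ s : ℝ,
      (s ∈ Icc (0 : ℝ) 1 ∧ ∀ᶠ h in 𝓝[≥] (0 : ℝ), s + σ * h ∈ Icc (0 : ℝ) 1) ∧
      (s : UnitAddCircle) = x := by
    obtain ⟨s, hs, rfl⟩ := UnitAddCircle.eq_coe_Ico x
    rcases hσ with rfl | rfl
    · refine ⟨s, ⟨⟨hs.1, hs.2.le⟩, ?_⟩, rfl⟩
      filter_upwards [Icc_mem_nhdsGE (sub_pos.2 hs.2)] with h hh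
      exact ⟨by linarith [hh.1, hs.1], by linarith [hh.2]⟩
    · rcases hs.1.lt_or_eq with h0 | rfl
      · refine ⟨s, ⟨⟨hs.1, hs.2.le⟩, ?_⟩, rfl⟩
        filter_upwards [Icc_mem_nhdsGE h0] with h hh
        exact ⟨by linarith [hh.2], by linarith [hh.1, hs.2]⟩
      · refine ⟨1, ⟨⟨zero_le_one, le_rfl⟩, ?_⟩, by rw [AddCircle.coe_period, AddCircle.coe_zero]⟩
        filter_upwards [Icc_mem_nhdsGE (zero_lt_one' ℝ)] with h hh
        exact ⟨by linarith [hh.2], by linarith [hh.1]⟩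
  obtain ⟨m, hm⟩ := hf s σ
  refine ⟨m, ?_⟩
  filter_upwards [hm, hs.2] with h h₁ h₂
  rw [← AddCircle.coe_add, AddCircle.liftIco_one_coe h01 h₂, AddCircle.liftIco_one_coe h01 hs.1, h₁]

/-- The linear combination of the functions `φ k` with vector coefficients `w k`. -/
noncomputable def linComb {κ X : Type*} [Fintype κ] (φ : κ → X → ℝ) (w : κ → E) (x : X) : E :=
  ∑ k, φ k x • w k

theorem continuous_linComb {κ X : Type*} [Fintype κ] [TopologicalSpace X] {φ : κ → X → ℝ}
    (hφ : ∀ k, Continuous (φ k)) : Continuous fun p : (κ → E) × X => linComb φ p.1 p.2 := by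
  unfold linComb
  exact continuous_finsetSum _ fun k _ =>
    ((hφ k).comp continuous_snd).smul ((continuous_apply k).comp continuous_fst)

theorem eventually_nhds_exists_translate (x : UnitAddCircle) (i : Fin 2) {δ : ℝ} (hδ : 0 < δ) :
    ∀ᶠ p in 𝓝 (x, i), ∃ h : ℝ, |h| < δ ∧ p = (x + (h : UnitAddCircle), i) := by
  obtain ⟨s, -, rfl⟩ := UnitAddCircle.eq_coe_Ico x
  have hs : 𝓝 (s : UnitAddCircle) = map (fun r : ℝ => (r : UnitAddCircle)) (𝓝 s) :=
    QuotientAddGroup.nhds_eq _ _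
  rw [nhds_prod_eq, nhds_discrete (Fin 2), prod_pure, eventually_map, hs, eventually_map]
  filter_upwards [Metric.ball_mem_nhds s hδ] with y hy
  refine ⟨y - s, hy, ?_⟩
  rw [← AddCircle.coe_add, add_sub_cancel]

/-- The functions on two circles which are affine near each point on both sides of it. -/
def SideAffine (f : UnitAddCircle × Fin 2 → ℝ) : Prop :=
  ∀ x i σ, σ = 1 ∨ σ = -1 → ∃ m : ℝ, ∀ᶠ h in 𝓝[≥] (0 : ℝ),
    f (x + ((σ * h : ℝ) : UnitAddCircle), i) = f (x, i) + h * m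

variable {κ : Type*} [Fintype κ] {φ : κ → UnitAddCircle × Fin 2 → ℝ}

theorem SideAffine.exists_linComb (hφ : ∀ k, SideAffine (φ k)) (x : UnitAddCircle) (i : Fin 2) :
    ∃ δ > 0, ∃ m₁ m₂ : κ → ℝ, ∀ (w : κ → E) (h : ℝ), |h| < δ →
      linComb φ w (x + (h : UnitAddCircle), i) =
        linComb φ w (x, i) + (max h 0 • ∑ k, m₁ k • w k + max (-h) 0 • ∑ k, m₂ k • w k) := by
  choose m₁ h₁ using fun k => hφ k x i 1 (Or.inl rfl)
  choose m₂ h₂ using fun k => hφ k x i (-1) (Or.inr rfl)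
  have hev := (eventually_all.2 h₁).and (eventually_all.2 h₂)
  obtain ⟨δ, hδ, hsub⟩ := (mem_nhdsGE_iff_exists_Ico_subset (a := (0 : ℝ))).1 hev
  refine ⟨δ, hδ, m₁, m₂, fun w h hh => ?_⟩
  obtain ⟨hl, hr⟩ := abs_lt.1 hh
  simp only [linComb, Finset.smul_sum, smul_smul, ← Finset.sum_add_distrib, ← add_smul]
  refine Finset.sum_congr rfl fun k _ => ?_
  congr 1
  rcases le_total 0 h with h0 | h0
  · rw [max_eq_left h0, max_eq_right (by linarith)]
    simpa using (hsub (⟨h0, hr⟩ : h ∈ Ico 0 δ)).1 k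
  · rw [max_eq_right h0, max_eq_left (by linarith)]
    simpa using (hsub (⟨by linarith, by linarith⟩ : -h ∈ Ico 0 δ)).2 k

theorem SideAffine.eventually_locally_injective (hφ : ∀ k, SideAffine (φ k)) {w : κ → E}
    (hw : Function.Injective (linComb φ w)) (x : UnitAddCircle) (i : Fin 2) :
    ∀ᶠ q in 𝓝 (w, ((x, i), (x, i))),
      linComb φ q.1 q.2.1 = linComb φ q.1 q.2.2 → q.2.1 = q.2.2 := by
  obtain ⟨δ, hδ, m₁, m₂, hm⟩ := exists_linComb (E := E) hφ x i
  set D₁ : (κ → E) → E := fun w => ∑ k, m₁ k • w k with hD₁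
  set D₂ : (κ → E) → E := fun w => ∑ k, m₂ k • w k with hD₂
  have c₁ : Continuous D₁ := by fun_prop
  have c₂ : Continuous D₂ := by fun_prop
  have key : ∀ t ∈ Icc (0 : ℝ) 1, t • D₁ w - (1 - t) • D₂ w ≠ 0 := by
    intro t ht h0
    obtain ⟨ε, hε, hε'⟩ := exists_between (lt_min hδ one_pos)
    obtain ⟨hεδ, hε1⟩ := lt_min_iff.1 hε'
    have ha := hm w (ε * t) (by rw [abs_of_nonneg (mul_nonneg hε.le ht.1)]; nlinarith [ht.2])
    have hb := hm w (-(ε * (1 - t))) (by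
      rw [abs_neg, abs_of_nonneg (mul_nonneg hε.le (by linarith [ht.2]))]; nlinarith [ht.1])
    rw [max_eq_left (mul_nonneg hε.le ht.1),
      max_eq_right (by linarith [mul_nonneg hε.le ht.1])] at ha
    rw [neg_neg, max_eq_left (mul_nonneg hε.le (by linarith [ht.2])),
      max_eq_right (by linarith [mul_nonneg hε.le (by linarith [ht.2] : 0 ≤ 1 - t)])] at hb
    have heq := hw (ha.trans (Eq.trans (by
      have : t • D₁ w = (1 - t) • D₂ w := sub_eq_zero.1 h0
      simp only [zero_smul, add_zero, zero_add, mul_smul]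
      exact congrArg (fun z => linComb φ w (x, i) + ε • z) this) hb.symm))
    have h1 := add_left_cancel (Prod.ext_iff.1 heq).1
    have h2 : ((ε : ℝ) : UnitAddCircle) = 0 := by
      rw [← sub_eq_zero, ← AddCircle.coe_sub] at h1
      rwa [show ε * t - -(ε * (1 - t)) = ε by ring] at h1
    rw [AddCircle.coe_eq_zero_iff_of_mem_Ico (p := 1) ⟨hε.le, hε1⟩] at h2
    exact hε.ne' h2
  have hopen : ∀ᶠ w' in 𝓝 w, ∀ t ∈ Icc (0 : ℝ) 1, t • D₁ w' - (1 - t) • D₂ w' ≠ 0 := by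
    refine isCompact_Icc.eventually_forall_of_forall_eventually fun t ht => ?_
    exact ContinuousAt.eventually_ne (by fun_prop) (key t ht)
  have hnear := eventually_nhds_exists_translate x i hδ
  rw [nhds_prod_eq, nhds_prod_eq]
  filter_upwards [hopen.prod_mk (hnear.prod_mk hnear)]
  rintro ⟨w', p, q⟩ ⟨hw', ⟨h, hh, rfl⟩, ⟨h', hh', rfl⟩⟩ heq
  simp only at hw' heq ⊢
  suffices h = h' by rw [this]
  wlog hlt : h' < h generalizing h h'
  · by_contra hne
    exact hne (this h' hh' h hh heq.symm (lt_of_le_of_ne (not_lt.1 hlt) hne)).symm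
  rw [hm w' h hh, hm w' h' hh', add_right_inj] at heq
  have e : ∀ a : ℝ, max a 0 - max (-a) 0 = a := fun a => by
    rcases le_total 0 a with ha | ha
    · rw [max_eq_left ha, max_eq_right (by linarith)]; ring
    · rw [max_eq_right ha, max_eq_left (by linarith)]; ring
  set α := max h 0 - max h' 0 with hα
  set β := max (-h') 0 - max (-h) 0 with hβ
  have hα0 : 0 ≤ α := sub_nonneg.2 (max_le_max hlt.le le_rfl)
  have hβ0 : 0 ≤ β := sub_nonneg.2 (max_le_max (by linarith) le_rfl)
  have hs : α + β = h - h' := by linarith [e h, e h']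
  have hpos : 0 < α + β := by linarith
  refine absurd ?_ (hw' (α / (α + β)) ⟨by positivity, (div_le_one hpos).2 (by linarith)⟩)
  have h1 : α • D₁ w' - β • D₂ w' = 0 := by
    rw [hα, hβ, sub_smul, sub_smul]
    rw [← sub_eq_zero] at heq
    rw [← heq]
    abel
  rw [show 1 - α / (α + β) = (α + β)⁻¹ * β by field_simp; ring, div_eq_inv_mul, mul_smul,
    mul_smul, ← smul_sub, h1, smul_zero]

/-- Injectivity is stable under small changes of the coefficients. -/
theorem SideAffine.eventually_injective (hφ : ∀ k, SideAffine (φ k)) (hc : ∀ k, Continuous (φ k))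
    {w : κ → E} (hw : Function.Injective (linComb φ w)) :
    ∀ᶠ w' in 𝓝 w, Function.Injective (linComb φ w') := by
  have hcont := continuous_linComb (E := E) hc
  have := (isCompact_univ (X := (UnitAddCircle × Fin 2) × (UnitAddCircle × Fin 2))
    ).eventually_forall_of_forall_eventually (x₀ := w)
    (P := fun w' q => linComb φ w' q.1 = linComb φ w' q.2 → q.1 = q.2) ?_
  · filter_upwards [this] with w' h p q hpq
    exact h (p, q) (mem_univ _) hpq
  · rintro ⟨p, q⟩ -
    by_cases hpq : p = q
    · subst hpq
      exact eventually_locally_injective hφ hw p.1 p.2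
    · have : ∀ᶠ z in 𝓝 (w, (p, q)), linComb φ z.1 z.2.1 ≠ linComb φ z.1 z.2.2 := by
        have h₁ : Continuous fun z : (κ → E) × (UnitAddCircle × Fin 2) × (UnitAddCircle × Fin 2) =>
            linComb φ z.1 z.2.1 - linComb φ z.1 z.2.2 :=
          (hcont.comp (by fun_prop : Continuous fun z : (κ → E) × (UnitAddCircle × Fin 2) ×
            (UnitAddCircle × Fin 2) => (z.1, z.2.1))).sub
          (hcont.comp (by fun_prop : Continuous fun z : (κ → E) × (UnitAddCircle × Fin 2) ×
            (UnitAddCircle × Fin 2) => (z.1, z.2.2)))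
        filter_upwards [h₁.continuousAt.eventually_ne (sub_ne_zero.2 fun h => hpq (hw h))] with z hz
        exact sub_ne_zero.1 hz
      filter_upwards [this] with z hz h
      exact absurd h hz

theorem ordConnected_preimage_of_convex {L : UnitAddCircle × Fin 2 → E} (hc : Continuous L)
    (hi : Function.Injective L) {C : Set E} (hC : Convex ℝ C) (hCL : C ⊆ range L) {i : Fin 2}
    (h0 : L (0, i) ∉ C) : {s : ℝ | s ∈ Ioo (0 : ℝ) 1 ∧ L (s, i) ∈ C}.OrdConnected := by
  rcases eq_empty_or_nonempty {s : ℝ | s ∈ Ioo (0 : ℝ) 1 ∧ L (s, i) ∈ C} with he | ⟨s₀, -, hs₀⟩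
  · rw [he]; exact ordConnected_empty
  have hA : IsPreconnected (L ⁻¹' C) := by
    rw [← (hc.isClosedEmbedding hi).isInducing.isPreconnected_image,
      image_preimage_eq_of_subset hCL]
    exact hC.isPreconnected
  have hsnd : ∀ p ∈ L ⁻¹' C, p.2 = i := fun p hp =>
    (hA.image Prod.snd continuous_snd.continuousOn).subsingleton (mem_image_of_mem _ hp)
      (mem_image_of_mem Prod.snd (show ((s₀ : UnitAddCircle), i) ∈ L ⁻¹' C from hs₀))
  have hB : IsPreconnected ((fun p : UnitAddCircle × Fin 2 =>
      (AddCircle.equivIco (1 : ℝ) 0 p.1 : ℝ)) '' (L ⁻¹' C)) := by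
    refine hA.image _ fun p hp => ContinuousAt.continuousWithinAt ?_
    have hp1 : p.1 ≠ ((0 : ℝ) : UnitAddCircle) := by
      intro h
      apply h0
      have : p = (0, i) := Prod.ext h (hsnd p hp)
      rwa [← this]
    exact (continuous_subtype_val.continuousAt.comp
      (AddCircle.continuousAt_equivIco 1 0 hp1)).comp continuous_fst.continuousAt
  suffices h : {s : ℝ | s ∈ Ioo (0 : ℝ) 1 ∧ L (s, i) ∈ C} = (fun p : UnitAddCircle × Fin 2 =>
      (AddCircle.equivIco (1 : ℝ) 0 p.1 : ℝ)) '' (L ⁻¹' C) from h ▸ hB.ordConnected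
  ext s
  constructor
  · rintro ⟨hs, hsC⟩
    refine ⟨(s, i), hsC, ?_⟩
    simp only
    rw [AddCircle.equivIco_coe_of_mem (p := (1 : ℝ)) (a := 0) (by simpa using ⟨hs.1.le, hs.2⟩)]
  · rintro ⟨⟨x, j⟩, hp, rfl⟩
    obtain rfl : j = i := hsnd _ hp
    obtain ⟨s, hs, rfl⟩ := UnitAddCircle.eq_coe_Ico x
    simp only
    rw [AddCircle.equivIco_coe_of_mem (p := (1 : ℝ)) (a := 0) (by simpa using hs)]
    refine ⟨⟨hs.1.lt_of_ne ?_, hs.2⟩, hp⟩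
    rintro rfl
    exact h0 hp

theorem exists_convex_frequently_mem {L : UnitAddCircle × Fin 2 → E} (hc : Continuous L)
    (hi : Function.Injective L) {S : Finset (E × E)}
    (hS : range L = ⋃ p ∈ S, segment ℝ p.1 p.2) (i : Fin 2) {l : Filter ℝ} [l.NeBot]
    (hl : ∀ᶠ s in l, s ∈ Ioo (0 : ℝ) 1) :
    ∃ (p q : E) (J : Set ℝ), J.OrdConnected ∧ (∀ s ∈ J, s ∈ Ioo (0 : ℝ) 1 ∧
      L (s, i) ∈ segment ℝ p q) ∧ ∃ᶠ s in l, s ∈ J := by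
  suffices h : ∃ (p q : E) (C : Set E), Convex ℝ C ∧ C ⊆ segment ℝ p q ∧
      segment ℝ p q ⊆ range L ∧ L (0, i) ∉ C ∧ ∃ᶠ s in l, L ((s : ℝ), i) ∈ C by
    obtain ⟨p, q, C, hC, hCs, hsL, h0, hf⟩ := h
    exact ⟨p, q, _, ordConnected_preimage_of_convex hc hi hC (hCs.trans hsL) h0,
      fun s hs => ⟨hs.1, hCs hs.2⟩, (hl.and_frequently hf)⟩
  have h1 : ∃ᶠ s in l, ∃ pq ∈ (S : Set (E × E)), L ((s : ℝ), i) ∈ segment ℝ pq.1 pq.2 := by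
    refine Eventually.frequently (Eventually.of_forall fun s => ?_)
    have : L ((s : ℝ), i) ∈ range L := mem_range_self _
    rw [hS] at this
    simpa using this
  obtain ⟨⟨p, q⟩, hpq, hf⟩ := (frequently_exists_finite S.finite_toSet).1 h1
  have hsub : segment ℝ p q ⊆ range L := by
    rw [hS]
    exact subset_biUnion_of_mem (u := fun p : E × E => segment ℝ p.1 p.2) hpq
  by_cases hm : L (0, i) ∈ segment ℝ p q
  · set ℓ : E → ℝ := fun z => inner ℝ (q - p) z with hℓ
    have hlin : IsLinearMap ℝ ℓ := ⟨fun _ _ => inner_add_right _ _ _,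
      fun _ _ => real_inner_smul_right _ _ _⟩
    have hinj : ∀ z ∈ segment ℝ p q, ℓ z = ℓ (L (0, i)) → z = L (0, i) := by
      rw [segment_eq_image'] at hm ⊢
      obtain ⟨b, -, hb⟩ := hm
      rintro _ ⟨a, -, rfl⟩ h
      rw [← hb] at h ⊢
      simp only [hℓ, inner_add_right, real_inner_smul_right, add_right_inj] at h
      rcases mul_eq_mul_right_iff.1 h with rfl | h
      · rfl
      · rw [inner_self_eq_zero.1 h]; simp
    have hor : ∃ᶠ s in l, L ((s : ℝ), i) ∈ segment ℝ p q ∩ {z | ℓ z < ℓ (L (0, i))} ∨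
        L ((s : ℝ), i) ∈ segment ℝ p q ∩ {z | ℓ (L (0, i)) < ℓ z} := by
      refine (hl.and_frequently hf).mono fun s hs => ?_
      have hne : ℓ (L (s, i)) ≠ ℓ (L (0, i)) := fun h => by
        have := (Prod.ext_iff.1 (hi (hinj _ hs.2 h))).1
        exact hs.1.1.ne'
          ((AddCircle.coe_eq_zero_iff_of_mem_Ico (p := 1) ⟨hs.1.1.le, hs.1.2⟩).1 this)
      rcases hne.lt_or_gt with h | h
      · exact Or.inl ⟨hs.2, h⟩
      · exact Or.inr ⟨hs.2, h⟩
    rcases frequently_or_distrib.1 hor with h | h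
    · exact ⟨p, q, _, (convex_segment p q).inter (convex_halfSpace_lt hlin _), inter_subset_left,
        hsub, fun h => lt_irrefl (ℓ (L (0, i))) h.2, h⟩
    · exact ⟨p, q, _, (convex_segment p q).inter (convex_halfSpace_gt hlin _), inter_subset_left,
        hsub, fun h => lt_irrefl (ℓ (L (0, i))) h.2, h⟩
  · exact ⟨p, q, _, convex_segment p q, subset_rfl, hsub, hm, hf⟩

theorem exists_segment_right {L : UnitAddCircle × Fin 2 → E} (hc : Continuous L)
    (hi : Function.Injective L) {S : Finset (E × E)}
    (hS : range L = ⋃ p ∈ S, segment ℝ p.1 p.2) (i : Fin 2) {x : ℝ} (hx : x ∈ Ico (0 : ℝ) 1) :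
    ∃ y ∈ Ioo x 1, ∃ p q, ∀ s ∈ Icc x y, L ((s : ℝ), i) ∈ segment ℝ p q := by
  have hev : ∀ᶠ s in 𝓝[>] x, s ∈ Ioo (0 : ℝ) 1 := by
    filter_upwards [Ioo_mem_nhdsGT hx.2] with s hs using ⟨hx.1.trans_lt hs.1, hs.2⟩
  obtain ⟨p, q, J, hJ, hJs, hf⟩ := exists_convex_frequently_mem hc hi hS i hev
  obtain ⟨y, hyJ, hy⟩ := (hf.and_eventually (Ioo_mem_nhdsGT hx.2)).exists
  refine ⟨y, hy, p, q, ?_⟩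
  have hIoc : ∀ s ∈ Ioc x y, L ((s : ℝ), i) ∈ segment ℝ p q := fun s hs => by
    obtain ⟨z, hzJ, hz⟩ := (hf.and_eventually (Ioo_mem_nhdsGT hs.1)).exists
    exact (hJs s (hJ.out hzJ hyJ ⟨hz.2.le, hs.2⟩)).2
  have hcl : IsClosed {s : ℝ | L ((s : ℝ), i) ∈ segment ℝ p q} := by
    have hseg : IsClosed (segment ℝ p q) := by
      rw [segment_eq_image]
      exact (isCompact_Icc.image (by fun_prop)).isClosed
    exact hseg.preimage (hc.comp ((AddCircle.continuous_mk' 1).prodMk continuous_const))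
  intro s hs
  have := closure_minimal hIoc hcl
  rw [closure_Ioc hy.1.ne] at this
  exact this hs

theorem exists_segment_left {L : UnitAddCircle × Fin 2 → E} (hc : Continuous L)
    (hi : Function.Injective L) {S : Finset (E × E)}
    (hS : range L = ⋃ p ∈ S, segment ℝ p.1 p.2) (i : Fin 2) {x : ℝ} (hx : x ∈ Ioc (0 : ℝ) 1) :
    ∃ y ∈ Ioo 0 x, ∃ p q, ∀ s ∈ Icc y x, L ((s : ℝ), i) ∈ segment ℝ p q := by
  have hn : Continuous fun p : UnitAddCircle × Fin 2 => L (-p.1, p.2) := by fun_prop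
  have hni : Function.Injective fun p : UnitAddCircle × Fin 2 => L (-p.1, p.2) := fun p q h => by
    have := hi h
    simpa [Prod.ext_iff] using this
  have hr : range (fun p : UnitAddCircle × Fin 2 => L (-p.1, p.2)) = range L :=
    ((Equiv.neg UnitAddCircle).prodCongr (Equiv.refl (Fin 2))).surjective.range_comp L
  obtain ⟨y, hy, p, q, h⟩ := exists_segment_right hn hni (hr.trans hS) i
    (x := 1 - x) ⟨by linarith [hx.2], by linarith [hx.1]⟩
  refine ⟨1 - y, ⟨by linarith [hy.2], by linarith [hy.1]⟩, p, q, fun s hs => ?_⟩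
  have := h (1 - s) ⟨by linarith [hs.2], by linarith [hs.1]⟩
  rwa [← AddCircle.coe_neg, neg_sub, AddCircle.coe_sub, AddCircle.coe_period, sub_zero] at this

/-- An injective path in a segment is a monotone parametrization of the segment between its
endpoints. -/
theorem exists_monotone_parameter {M : ℝ → E} (hM : Continuous M) {a b : ℝ} (hab : a < b)
    (hinj : InjOn M (Icc a b)) {p q : E} (hseg : ∀ s ∈ Icc a b, M s ∈ segment ℝ p q) :
    ∃ c : ℝ → ℝ, Continuous c ∧ StrictMonoOn c (Icc a b) ∧ c a = 0 ∧ c b = 1 ∧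
      ∀ s ∈ Icc a b, M s = (1 - c s) • M a + c s • M b := by
  have ha : a ∈ Icc a b := left_mem_Icc.2 hab.le
  have hb : b ∈ Icc a b := right_mem_Icc.2 hab.le
  set d := M b - M a with hd
  have hd0 : d ≠ 0 := sub_ne_zero.2 fun h => hab.ne' (hinj hb ha h)
  have hdd : inner ℝ d d ≠ 0 := fun h => hd0 (inner_self_eq_zero.1 h)
  have hline : ∀ s ∈ Icc a b, ∃ μ : ℝ, M s - M a = μ • d := by
    have h : ∀ s ∈ Icc a b, ∃ μ : ℝ, M s - M a = μ • (q - p) := fun s hs => by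
      obtain ⟨α, -, hα⟩ := (segment_eq_image' ℝ p q ▸ hseg s hs :)
      obtain ⟨β, -, hβ⟩ := (segment_eq_image' ℝ p q ▸ hseg a ha :)
      exact ⟨α - β, by rw [← hα, ← hβ, add_sub_add_left_eq_sub, sub_smul]⟩
    obtain ⟨ν, hν⟩ := h b hb
    have hν0 : ν ≠ 0 := by rintro rfl; exact hd0 (by rw [hd, hν, zero_smul])
    intro s hs
    obtain ⟨μ, hμ⟩ := h s hs
    exact ⟨μ / ν, by rw [hμ, hd, hν, smul_smul, div_mul_cancel₀ _ hν0]⟩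
  set c : ℝ → ℝ := fun s => inner ℝ d (M s - M a) / inner ℝ d d with hc
  have hcs : ∀ s ∈ Icc a b, M s - M a = c s • d := fun s hs => by
    obtain ⟨μ, hμ⟩ := hline s hs
    rw [hc]
    simp only
    rw [hμ, real_inner_smul_right, mul_div_cancel_right₀ _ hdd]
  have hcc : Continuous c := by fun_prop
  have hca : c a = 0 := by simp [hc]
  have hcb : c b = 1 := div_self hdd
  refine ⟨c, hcc, ?_, hca, hcb, fun s hs => ?_⟩
  · refine hcc.continuousOn.strictMonoOn_of_injOn_Icc hab.le
      (by rw [hca, hcb]; exact zero_le_one) ?_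
    intro s hs t ht h
    exact hinj hs ht (sub_left_injective (b := M a) (by
      simp only
      rw [hcs s hs, hcs t ht, h]))
  · rw [← sub_add_cancel (M s) (M a), hcs s hs, hd]
    module

/-- `M` restricted to `[0, b]` is an increasing reparametrization of a polygonal path. -/
def IsPolylineOn (M : ℝ → E) (b : ℝ) : Prop :=
  ∃ (n : ℕ) (v : ℕ → E) (f : ℝ → ℝ), Continuous f ∧ StrictMonoOn f (Icc 0 b) ∧ f 0 = 0 ∧
    f b = n ∧ ∀ s ∈ Icc 0 b, M s = polyline n v (f s)

theorem isPolylineOn_zero (M : ℝ → E) : IsPolylineOn M 0 :=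
  ⟨0, fun _ => M 0, fun _ => 0, continuous_const, by
    rw [Icc_self]; exact subsingleton_singleton.strictMonoOn _, rfl, by simp, fun s hs => by
    obtain rfl : s = 0 := by simpa using hs
    rw [polyline_zero]⟩

theorem IsPolylineOn.extend {M : ℝ → E} (hM : Continuous M) {a b : ℝ} (h : IsPolylineOn M a)
    (ha : 0 ≤ a) (hab : a < b) (hinj : InjOn M (Icc a b)) {p q : E}
    (hseg : ∀ s ∈ Icc a b, M s ∈ segment ℝ p q) : IsPolylineOn M b := by
  obtain ⟨n, v, f, hf, hmono, hf0, hfa, hMf⟩ := h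
  obtain ⟨c, hc, hcm, hca, hcb, hMc⟩ := exists_monotone_parameter hM hab hinj hseg
  have hf_nonneg : ∀ s ∈ Icc 0 a, f s ∈ Icc 0 (n : ℝ) := fun s hs =>
    ⟨hf0 ▸ hmono.monotoneOn ⟨le_rfl, ha⟩ hs hs.1, hfa ▸ hmono.monotoneOn hs ⟨ha, le_rfl⟩ hs.2⟩
  have hc_mem : ∀ s ∈ Icc a b, c s ∈ Icc (0 : ℝ) 1 := fun s hs =>
    ⟨hca ▸ hcm.monotoneOn ⟨le_rfl, hab.le⟩ hs hs.1, hcb ▸ hcm.monotoneOn hs ⟨hab.le, le_rfl⟩ hs.2⟩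
  have hMa : M a = v n := by rw [hMf a ⟨ha, le_rfl⟩, hfa, polyline_natCast]
  set v' : ℕ → E := Function.update v (n + 1) (M b) with hv'
  have hvv : ∀ k ≤ n, v' k = v k := fun k hk => Function.update_of_ne (by omega) _ _
  set f' : ℝ → ℝ := fun s => f (min s a) + c (max s a) with hf'
  have hle : ∀ s ≤ a, f' s = f s := fun s hs => by
    simp only [hf', min_eq_left hs, max_eq_right hs, hca, add_zero]
  have hge : ∀ s, a ≤ s → f' s = n + c s := fun s hs => by
    simp only [hf', min_eq_right hs, max_eq_left hs, hfa]
  refine ⟨n + 1, v', f', by fun_prop, ?_, by rw [hle 0 ha, hf0], by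
    rw [hge b hab.le, hcb]; push_cast; ring, fun s hs => ?_⟩
  · intro s hs t ht hst
    rcases le_or_gt t a with hta | hta
    · rw [hle s (hst.le.trans hta), hle t hta]
      exact hmono ⟨hs.1, hst.le.trans hta⟩ ⟨ht.1, hta⟩ hst
    · have hct : 0 < c t := hca ▸ hcm ⟨le_rfl, hab.le⟩ ⟨hta.le, ht.2⟩ hta
      rw [hge t hta.le]
      rcases le_or_gt s a with hsa | hsa
      · rw [hle s hsa]
        linarith [(hf_nonneg s ⟨hs.1, hsa⟩).2]
      · rw [hge s hsa.le]
        linarith [hcm ⟨hsa.le, hs.2⟩ ⟨hta.le, ht.2⟩ hst]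
  · rcases le_or_gt s a with hsa | hsa
    · rw [hMf s ⟨hs.1, hsa⟩, hle s hsa, polyline_succ, polyline_congr hvv,
        hat_of_le_neg_one, zero_smul, add_zero]
      push_cast
      linarith [(hf_nonneg s ⟨hs.1, hsa⟩).2]
    · have := hc_mem s ⟨hsa.le, hs.2⟩
      rw [hge s hsa.le, polyline_natCast_add n.lt_succ_self v' this.1 this.2, hvv n le_rfl, ← hMa,
        hMc s ⟨hsa.le, hs.2⟩, hv', Function.update_self]

theorem isPolylineOn_one {L : UnitAddCircle × Fin 2 → E} (hc : Continuous L)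
    (hi : Function.Injective L) {S : Finset (E × E)}
    (hS : range L = ⋃ p ∈ S, segment ℝ p.1 p.2) (i : Fin 2) :
    IsPolylineOn (fun s : ℝ => L (s, i)) 1 := by
  set M : ℝ → E := fun s => L (s, i) with hMdef
  have hM : Continuous M := hc.comp ((AddCircle.continuous_mk' 1).prodMk continuous_const)
  have hinj : InjOn M (Ico 0 1) := fun s hs t ht h =>
    UnitAddCircle.coe_injOn hs ht (Prod.ext_iff.1 (hi h)).1
  have hinj' : InjOn M (Ioc 0 1) := fun s hs t ht h => by
    have h' := (Prod.ext_iff.1 (hi h)).1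
    exact (AddCircle.coe_eq_coe_iff_of_mem_Ioc (p := (1 : ℝ)) (a := 0) (by simpa using hs)
      (by simpa using ht)).1 h'
  set B := {b : ℝ | b ∈ Icc (0 : ℝ) 1 ∧ IsPolylineOn M b} with hB
  have hB0 : (0 : ℝ) ∈ B := ⟨⟨le_rfl, zero_le_one⟩, isPolylineOn_zero M⟩
  have hbdd : BddAbove B := ⟨1, fun b hb => hb.1.2⟩
  set x := sSup B with hx
  have hx0 : 0 ≤ x := le_csSup hbdd hB0
  have hx1 : x ≤ 1 := csSup_le ⟨0, hB0⟩ fun b hb => hb.1.2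
  have hxB : IsPolylineOn M x := by
    rcases hx0.eq_or_lt with h | h
    · rw [← h]; exact hB0.2
    · obtain ⟨y, hy, p, q, hseg⟩ := exists_segment_left hc hi hS i (x := x) ⟨h, hx1⟩
      obtain ⟨a, ha, hya⟩ := exists_lt_of_lt_csSup ⟨0, hB0⟩ hy.2
      rcases (le_csSup hbdd ha).eq_or_lt with hax | hax
      · rw [hx, ← hax]; exact ha.2
      · exact ha.2.extend hM ha.1.1 hax
          (hinj'.mono <| by exact fun s hs => ⟨(hy.1.trans hya).trans_le hs.1, hs.2.trans hx1⟩)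
          fun s hs => hseg s ⟨hya.le.trans hs.1, hs.2⟩
  rcases hx1.eq_or_lt with h | h
  · rwa [← h]
  · obtain ⟨y, hy, p, q, hseg⟩ := exists_segment_right hc hi hS i (x := x) ⟨hx0, h⟩
    have hyB : y ∈ B := ⟨⟨hx0.trans hy.1.le, hy.2.le⟩, hxB.extend hM hx0 hy.1
      (hinj.mono <| by exact fun s hs => ⟨hx0.trans hs.1, hs.2.trans_lt hy.2⟩) hseg⟩
    exact absurd (le_csSup hbdd hyB) (not_le.2 hy.1)

/-- The tent function on `[0, 1]` centred at `k / n`, wrapped around when `k = 0`. -/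
noncomputable def cyclicHat (n k : ℕ) (s : ℝ) : ℝ :=
  hat (n * s + -k) + if k = 0 then hat (n * s + -n) else 0

theorem continuous_cyclicHat (n k : ℕ) : Continuous (cyclicHat n k) := by
  unfold cyclicHat
  have := continuous_hat
  split_ifs <;> fun_prop

theorem rayAffine_cyclicHat (n k : ℕ) : RayAffine (cyclicHat n k) := by
  refine (rayAffine_hat.comp_affine n (-k)).add ?_
  split_ifs
  · exact rayAffine_hat.comp_affine n (-n)
  · simpa using RayAffine.affine 0 0

theorem cyclicHat_zero_eq_one {n k : ℕ} (hk : k < n) : cyclicHat n k 0 = cyclicHat n k 1 := by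
  have hn : (1 : ℝ) ≤ n := by exact_mod_cast (by omega : 1 ≤ n)
  rcases k.eq_zero_or_pos with rfl | h
  · simp only [cyclicHat, if_true, mul_zero, mul_one, Nat.cast_zero, neg_zero, add_zero, zero_add,
      add_neg_cancel]
    rw [hat_of_one_le hn, hat_of_le_neg_one (u := -(n : ℝ)) (by linarith), add_zero, zero_add]
  · have h1 : (1 : ℝ) ≤ k := by exact_mod_cast h
    have h2 : (k : ℝ) + 1 ≤ n := by exact_mod_cast hk
    simp only [cyclicHat, if_neg h.ne', mul_zero, mul_one, zero_add, add_zero]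
    rw [hat_of_le_neg_one (by linarith), hat_of_one_le (by linarith)]

theorem sum_cyclicHat {n : ℕ} (hn : 0 < n) {v : ℕ → E} (hv : v n = v 0) (s : ℝ) :
    ∑ k : Fin n, cyclicHat n k s • v k = polyline n v (n * s) := by
  rw [Fin.sum_univ_eq_sum_range (fun k => cyclicHat n k s • v k), polyline, Finset.sum_range_succ]
  simp only [cyclicHat, add_smul, ite_smul, zero_smul, Finset.sum_add_distrib, Finset.sum_ite_eq',
    Finset.mem_range, hn, if_true, hv, sub_eq_add_neg]

/-- The basis functions of the space of pairs of closed polygons with `n i` edges. -/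
noncomputable def linkBasis (n : Fin 2 → ℕ) (k : Σ i, Fin (n i)) (x : UnitAddCircle × Fin 2) : ℝ :=
  if x.2 = k.1 then AddCircle.liftIco 1 0 (cyclicHat (n k.1) k.2) x.1 else 0

theorem continuous_linkBasis (n : Fin 2 → ℕ) (k : Σ i, Fin (n i)) : Continuous (linkBasis n k) := by
  rw [continuous_prod_of_discrete_right]
  intro i
  simp only [linkBasis]
  split_ifs
  · exact AddCircle.liftIco_zero_continuous (cyclicHat_zero_eq_one k.2.2)
      (continuous_cyclicHat _ _).continuousOn
  · exact continuous_const

theorem sideAffine_linkBasis (n : Fin 2 → ℕ) (k : Σ i, Fin (n i)) : SideAffine (linkBasis n k) := by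
  intro x i σ hσ
  unfold linkBasis
  split_ifs
  · exact (rayAffine_cyclicHat _ _).liftIco (cyclicHat_zero_eq_one k.2.2) x hσ
  · exact ⟨0, by simp⟩

theorem linComb_linkBasis_coe {n : Fin 2 → ℕ} (w : (Σ i, Fin (n i)) → E) {i : Fin 2}
    (hn : 0 < n i) {v : ℕ → E} (hv : v (n i) = v 0) (hw : ∀ k : Fin (n i), w ⟨i, k⟩ = v k)
    {s : ℝ} (hs : s ∈ Icc (0 : ℝ) 1) :
    linComb (linkBasis n) w (s, i) = polyline (n i) v (n i * s) := by
  rw [← sum_cyclicHat hn hv, linComb, Fintype.sum_sigma, Finset.sum_eq_single i]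
  · refine Finset.sum_congr rfl fun k _ => ?_
    rw [linkBasis, if_pos rfl, AddCircle.liftIco_one_coe (cyclicHat_zero_eq_one k.2) hs, hw]
  · intro j _ hj
    exact Finset.sum_eq_zero fun k _ => by rw [linkBasis, if_neg (Ne.symm hj), zero_smul]
  · simp

theorem range_linComb_linkBasis {n : Fin 2 → ℕ} (hn : ∀ i, 0 < n i) (w : (Σ i, Fin (n i)) → E) :
    ∃ S : Finset (E × E), range (linComb (linkBasis n) w) = ⋃ p ∈ S, segment ℝ p.1 p.2 := by
  classical
  set v : Fin 2 → ℕ → E := fun i k => if h : k < n i then w ⟨i, ⟨k, h⟩⟩ else w ⟨i, ⟨0, hn i⟩⟩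
    with hvdef
  have hv : ∀ i, v i (n i) = v i 0 := fun i => by simp [hvdef, hn i]
  have hw : ∀ i (k : Fin (n i)), w ⟨i, k⟩ = v i k := fun i k => by simp [hvdef]
  refine ⟨Finset.univ.biUnion fun i => (Finset.range (n i)).image fun j => (v i j, v i (j + 1)), ?_⟩
  have hr : range (linComb (linkBasis n) w) = ⋃ i, polyline (n i) (v i) '' Icc 0 (n i) := by
    ext z
    simp only [mem_range, mem_iUnion, mem_image]
    constructor
    · rintro ⟨⟨x, i⟩, rfl⟩
      obtain ⟨s, hs, rfl⟩ := UnitAddCircle.eq_coe_Ico x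
      exact ⟨i, n i * s, ⟨mul_nonneg (Nat.cast_nonneg _) hs.1,
        mul_le_of_le_one_right (Nat.cast_nonneg _) hs.2.le⟩,
        (linComb_linkBasis_coe w (hn i) (hv i) (hw i) ⟨hs.1, hs.2.le⟩).symm⟩
    · rintro ⟨i, u, hu, rfl⟩
      have hpos : (0 : ℝ) < n i := Nat.cast_pos.2 (hn i)
      refine ⟨((u / n i : ℝ), i), ?_⟩
      rw [linComb_linkBasis_coe w (hn i) (hv i) (hw i)
        ⟨div_nonneg hu.1 hpos.le, (div_le_one hpos).2 hu.2⟩, mul_div_cancel₀ _ hpos.ne']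
  rw [hr]
  simp only [polyline_image _ (hn _), Finset.set_biUnion_biUnion, Finset.set_biUnion_finset_image,
    Finset.mem_univ, iUnion_true, Finset.mem_range]

/-- The straight-line homotopy from a degree-one circle map with lift `F` to the identity. -/
noncomputable def slide (F : ℝ → ℝ) (x : UnitAddCircle) (t : ℝ) : UnitAddCircle :=
  AddCircle.liftIco 1 0 (fun s : ℝ => (((1 - t) * F s + t * s : ℝ) : UnitAddCircle)) x

theorem slide_coe (F : ℝ → ℝ) {s : ℝ} (hs : s ∈ Ico (0 : ℝ) 1) (t : ℝ) :
    slide F s t = (((1 - t) * F s + t * s : ℝ) : UnitAddCircle) :=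
  AddCircle.liftIco_zero_coe_apply hs

theorem slide_one (F : ℝ → ℝ) (x : UnitAddCircle) : slide F x 1 = x := by
  obtain ⟨s, hs, rfl⟩ := UnitAddCircle.eq_coe_Ico x
  rw [slide_coe F hs]
  simp

theorem continuous_slide {F : ℝ → ℝ} (hF : Continuous F) (h0 : F 0 = 0) (h1 : F 1 = 1) :
    Continuous fun p : UnitAddCircle × I01 => slide F p.1 p.2 := by
  have hG0 : Continuous fun p : ℝ × I01 =>
      (((1 - (p.2 : ℝ)) * F p.1 + p.2 * p.1 : ℝ) : UnitAddCircle) :=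
    (AddCircle.continuous_mk' 1).comp (by fun_prop)
  let G : C(ℝ × I01, UnitAddCircle) := ⟨_, hG0⟩
  have hG : Continuous (AddCircle.liftIco 1 0 G.curry) := by
    refine AddCircle.liftIco_zero_continuous ?_ G.curry.continuous.continuousOn
    ext t
    change (((1 - (t : ℝ)) * F 0 + t * 0 : ℝ) : UnitAddCircle) =
      (((1 - (t : ℝ)) * F 1 + t * 1 : ℝ) : UnitAddCircle)
    rw [h0, h1, mul_zero, mul_zero, add_zero, mul_one, mul_one, sub_add_cancel,
      AddCircle.coe_period, AddCircle.coe_zero]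
  exact (ContinuousEval.continuous_eval (F := C(I01, UnitAddCircle))).comp
    ((hG.comp continuous_fst).prodMk continuous_snd)

theorem slide_injective {F : ℝ → ℝ} (hF : StrictMonoOn F (Icc 0 1)) (h0 : F 0 = 0) (h1 : F 1 = 1)
    {t : ℝ} (ht : t ∈ Icc (0 : ℝ) 1) : Function.Injective fun x => slide F x t := by
  set θ : ℝ → ℝ := fun s => (1 - t) * F s + t * s with hθ
  have hmono : StrictMonoOn θ (Icc 0 1) := fun a ha b hb hab => by
    have := hF ha hb hab
    rcases ht.1.eq_or_lt with rfl | h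
    · simpa [hθ] using this
    · exact add_lt_add_of_le_of_lt (mul_le_mul_of_nonneg_left this.le (by linarith [ht.2]))
        (mul_lt_mul_of_pos_left hab h)
  have hmem : ∀ s ∈ Ico (0 : ℝ) 1, θ s ∈ Ico (0 : ℝ) 1 := fun s hs => by
    constructor
    · simpa [hθ, h0] using hmono.monotoneOn ⟨le_rfl, zero_le_one⟩ ⟨hs.1, hs.2.le⟩ hs.1
    · simpa [hθ, h1] using hmono ⟨hs.1, hs.2.le⟩ ⟨zero_le_one, le_rfl⟩ hs.2
  intro x y hxy
  obtain ⟨a, ha, rfl⟩ := UnitAddCircle.eq_coe_Ico x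
  obtain ⟨b, hb, rfl⟩ := UnitAddCircle.eq_coe_Ico y
  simp only [slide_coe F ha, slide_coe F hb] at hxy
  rw [hmono.injOn ⟨ha.1, ha.2.le⟩ ⟨hb.1, hb.2.le⟩
    (UnitAddCircle.coe_injOn (hmem a ha) (hmem b hb) hxy)]

/-- A polygonal link is a monotone reparametrization of a pair of closed polygons with uniformly
parametrized edges. -/
theorem exists_linComb_reparametrization {L : UnitAddCircle × Fin 2 → E} (hc : Continuous L)
    (hi : Function.Injective L) {S : Finset (E × E)}
    (hS : range L = ⋃ p ∈ S, segment ℝ p.1 p.2) :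
    ∃ (n : Fin 2 → ℕ) (w : (Σ i, Fin (n i)) → E) (F : Fin 2 → ℝ → ℝ), (∀ i, 0 < n i) ∧
      (∀ i, Continuous (F i) ∧ StrictMonoOn (F i) (Icc 0 1) ∧ F i 0 = 0 ∧ F i 1 = 1) ∧
      (∀ x i, L (x, i) = linComb (linkBasis n) w (slide (F i) x 0, i)) ∧
      Function.Injective (linComb (linkBasis n) w) := by
  choose n v f hf hmono hf0 hf1 hM using isPolylineOn_one hc hi hS
  have hn : ∀ i, 0 < n i := fun i => by
    have := hmono i ⟨le_rfl, zero_le_one⟩ ⟨zero_le_one, le_rfl⟩ one_pos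
    rw [hf0, hf1] at this
    exact_mod_cast this
  have hnR : ∀ i, (0 : ℝ) < n i := fun i => Nat.cast_pos.2 (hn i)
  have hv : ∀ i, v i (n i) = v i 0 := fun i => by
    have h0 := hM i 0 ⟨le_rfl, zero_le_one⟩
    have h1 := hM i 1 ⟨zero_le_one, le_rfl⟩
    simp only at h0 h1
    rw [hf0, polyline_zero] at h0
    rw [hf1, polyline_natCast] at h1
    rw [← h0, ← h1, AddCircle.coe_period, AddCircle.coe_zero]
  set w : (Σ i, Fin (n i)) → E := fun k => v k.1 k.2 with hw
  set F : Fin 2 → ℝ → ℝ := fun i s => f i s / n i with hF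
  have hFm : ∀ i, StrictMonoOn (F i) (Icc 0 1) := fun i a ha b hb hab =>
    div_lt_div_of_pos_right (hmono i ha hb hab) (hnR i)
  have hF0 : ∀ i, F i 0 = 0 := fun i => by simp [hF, hf0]
  have hF1 : ∀ i, F i 1 = 1 := fun i => by simp [hF, hf1, (hnR i).ne']
  have hFc : ∀ i, Continuous (F i) := fun i => (hf i).div_const _
  have hL : ∀ s ∈ Icc (0 : ℝ) 1, ∀ i, L ((s : ℝ), i) =
      linComb (linkBasis n) w ((F i s : ℝ), i) := fun s hs i => by
    have hFs : F i s ∈ Icc (0 : ℝ) 1 :=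
      ⟨hF0 i ▸ (hFm i).monotoneOn ⟨le_rfl, zero_le_one⟩ hs hs.1,
        hF1 i ▸ (hFm i).monotoneOn hs ⟨zero_le_one, le_rfl⟩ hs.2⟩
    rw [linComb_linkBasis_coe w (hn i) (hv i) (fun _ => rfl) hFs,
      mul_div_cancel₀ _ (hnR i).ne', ← hM i s hs]
  refine ⟨n, w, F, hn, fun i => ⟨hFc i, hFm i, hF0 i, hF1 i⟩, fun x i => ?_, ?_⟩
  · obtain ⟨s, hs, rfl⟩ := UnitAddCircle.eq_coe_Ico x
    rw [slide_coe _ hs, hL s ⟨hs.1, hs.2.le⟩]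
    simp
  · have hpre : ∀ x i, ∃ s : ℝ, s ∈ Icc (0 : ℝ) 1 ∧ ((F i s : ℝ) : UnitAddCircle) = x :=
      fun x i => by
        obtain ⟨u, hu, rfl⟩ := UnitAddCircle.eq_coe_Ico x
        obtain ⟨s, hs, rfl⟩ := intermediate_value_Icc zero_le_one (hFc i).continuousOn
          (show u ∈ Icc (F i 0) (F i 1) by rw [hF0, hF1]; exact ⟨hu.1, hu.2.le⟩)
        exact ⟨s, hs, rfl⟩
    rintro ⟨x, i⟩ ⟨y, j⟩ hxy
    obtain ⟨a, ha, rfl⟩ := hpre x i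
    obtain ⟨b, hb, rfl⟩ := hpre y j
    rw [← hL a ha, ← hL b hb] at hxy
    obtain ⟨hab, rfl⟩ := Prod.ext_iff.1 (hi hxy)
    simp only at hab
    have hcirc : ∀ s ∈ Icc (0 : ℝ) 1, ((F i s : ℝ) : UnitAddCircle) = slide (F i) s 0 := by
      intro s hs
      rcases hs.2.lt_or_eq with h | rfl
      · rw [slide_coe _ ⟨hs.1, h⟩]; simp
      · rw [hF1, AddCircle.coe_period, ← AddCircle.coe_zero, slide_coe _ ⟨le_rfl, one_pos⟩]
        simp [hF0]
    simp only [hcirc a ha, hcirc b hb, hab]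

/-- The unit circle in the plane is homeomorphic to `ℝ / ℤ`. -/
noncomputable def circleHomeomorph : Circle1 ≃ₜ UnitAddCircle :=
  (Homeomorph.subtype Complex.orthonormalBasisOneI.repr.toHomeomorph (p := fun z => ‖z‖ = 1)
      fun z => by simp).symm.trans <|
    (Homeomorph.setCongr (s := {z : ℂ | ‖z‖ = 1}) (t := Submonoid.unitSphere ℂ)
      (by ext; simp)).trans
    (AddCircle.homeomorphCircle'.symm.trans
      (AddCircle.homeomorphAddCircle (2 * Real.pi) 1 Real.two_pi_pos.ne' one_ne_zero))

/-- The point of `ℝ³` with given rational coordinates. -/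
noncomputable def ratPoint (c : Fin 3 → ℚ) : R3 := WithLp.toLp 2 fun i => (c i : ℝ)

theorem denseRange_ratPoint : DenseRange ratPoint :=
  (WithLp.toLp_surjective 2).denseRange.comp
    (DenseRange.piMap fun _ : Fin 3 => Rat.denseRange_cast (𝕜 := ℝ))
    (PiLp.continuous_toLp 2 _)

/-- The pair of closed polygons with uniformly parametrized edges and vertices `w`. -/
noncomputable def polygonPair (n : Fin 2 → ℕ) (w : (Σ i, Fin (n i)) → R3) (x : Circle1 × Fin 2) :
    R3 :=
  linComb (linkBasis n) w (circleHomeomorph x.1, x.2)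

theorem isotopic_polygonPair {L : UnitAddCircle × Fin 2 → R3} {n : Fin 2 → ℕ}
    {w w' : (Σ i, Fin (n i)) → R3} {F : Fin 2 → ℝ → ℝ}
    (hF : ∀ i, Continuous (F i) ∧ StrictMonoOn (F i) (Icc 0 1) ∧ F i 0 = 0 ∧ F i 1 = 1)
    (hL : ∀ x i, L (x, i) = linComb (linkBasis n) w (slide (F i) x 0, i))
    (hw : ∀ z ∈ segment ℝ w w', Function.Injective (linComb (linkBasis n) z)) :
    Isotopic (fun x => L (circleHomeomorph x.1, x.2)) (polygonPair n w') := by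
  refine ⟨fun q => linComb (linkBasis n) ((1 - (q.2 : ℝ)) • w + (q.2 : ℝ) • w')
    (slide (F q.1.2) (circleHomeomorph q.1.1) q.2, q.1.2),
    ?_, fun x => ?_, fun x => ?_, fun t => ?_⟩
  · have hs : Continuous fun q : (Circle1 × Fin 2) × I01 =>
        slide (F q.1.2) (circleHomeomorph q.1.1) q.2 := by
      have h : Continuous fun q : (Circle1 × I01) × Fin 2 =>
          slide (F q.2) (circleHomeomorph q.1.1) q.1.2 := by
        rw [continuous_prod_of_discrete_right]
        intro i
        obtain ⟨h1, -, h3, h4⟩ := hF i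
        exact (continuous_slide h1 h3 h4).comp
          ((circleHomeomorph.continuous.comp continuous_fst).prodMk continuous_snd)
      exact h.comp (by fun_prop : Continuous fun q : (Circle1 × Fin 2) × I01 =>
        ((q.1.1, q.2), q.1.2))
    exact (continuous_linComb (E := R3) (continuous_linkBasis n)).comp
      (Continuous.prodMk (by fun_prop) (hs.prodMk (by fun_prop)))
  · simp [i0, hL]
  · simp [i1, slide_one, polygonPair]
  · intro x y hxy
    have ht := t.2
    have h := hw _ ⟨1 - (t : ℝ), t, by linarith [ht.2], ht.1, by ring, rfl⟩ hxy
    obtain ⟨h1, h2⟩ := Prod.ext_iff.1 h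
    simp only at h1 h2
    rw [h2] at h1
    obtain ⟨-, h3, h4, h5⟩ := hF y.2
    exact Prod.ext (circleHomeomorph.injective (slide_injective h3 h4 h5 ht h1)) h2

end PolygonalLinks

/-- There are only countably many isotopy classes of polygonal (PL) links. -/
theorem countably_many_isotopy_classes_of_PL_links :
    ∃ S : Set (Circle1 × Fin 2 → R3), S.Countable ∧
      (∀ L ∈ S, Continuous L ∧ Function.Injective L ∧ IsPolygonal (Set.range L)) ∧
      ∀ L : Circle1 × Fin 2 → R3, Continuous L → Function.Injective L →
        IsPolygonal (Set.range L) → ∃ L' ∈ S, Isotopic L L' := by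
  refine ⟨{L | (Continuous L ∧ Function.Injective L ∧ IsPolygonal (range L)) ∧
    L ∈ range fun d : (Σ n : Fin 2 → ℕ, (Σ i, Fin (n i)) → Fin 3 → ℚ) =>
      polygonPair d.1 fun k => ratPoint (d.2 k)},
    (countable_range _).mono fun L hL => hL.2, fun L hL => hL.1, fun L hLc hLi ⟨T, hT⟩ => ?_⟩
  set e : Circle1 × Fin 2 ≃ₜ UnitAddCircle × Fin 2 :=
    circleHomeomorph.prodCongr (Homeomorph.refl (Fin 2)) with he
  obtain ⟨n, w, F, hn, hF, hL, hw⟩ := exists_linComb_reparametrization (L := L ∘ e.symm)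
    (hLc.comp e.symm.continuous) (hLi.comp e.symm.injective)
    ((e.symm.surjective.range_comp L).trans hT)
  obtain ⟨U, ⟨hU, hUc⟩, hUi⟩ := (LocallyConvexSpace.convex_basis (𝕜 := ℝ) w).mem_iff.1
    (SideAffine.eventually_injective (sideAffine_linkBasis n) (continuous_linkBasis n) hw)
  have hdense : DenseRange (Pi.map fun _ : Σ i, Fin (n i) => ratPoint) :=
    DenseRange.piMap fun _ => denseRange_ratPoint
  obtain ⟨c, hc⟩ := hdense.mem_nhds hU
  refine ⟨polygonPair n fun k => ratPoint (c k), ⟨⟨?_, ?_, ?_⟩, ⟨n, c⟩, rfl⟩, ?_⟩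
  · exact ((continuous_linComb (continuous_linkBasis n)).comp (Continuous.prodMk_right _)).comp
      e.continuous
  · exact Function.Injective.comp (hUi hc) e.injective
  · obtain ⟨S, hS⟩ := range_linComb_linkBasis hn fun k => ratPoint (c k)
    exact ⟨S, (e.surjective.range_comp _).trans hS⟩
  · have := isotopic_polygonPair hF hL fun z hz =>
      hUi (hUc.segment_subset (mem_of_mem_nhds hU) hc hz)
    have h : (fun x => (L ∘ e.symm) (circleHomeomorph x.1, x.2)) = L :=
      funext fun x => congrArg L (e.symm_apply_apply x)
    rw [h] at this
    exact this
end

section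
/- Let I and J be lists over the two-letter alphabet Fin 2 (letters '1' = 0 and '2' = 1). If the number of descents of J is at least 2 · (length of I), then I embeds in J (I is a sublist of J). -/
/-- The number of descents of a word over the alphabet `{1, 2}` (encoded as `Fin 2`,
with `1 = 0` and `2 = 1`): the number of positions where a `2` is immediately
followed by a `1`. -/
def numDescents (l : List (Fin 2)) : ℕ :=
  (l.zip l.tail).countP (fun p => decide (p.1 = 1 ∧ p.2 = 0))

theorem numDescents_cons_cons (x y : Fin 2) (t : List (Fin 2)) :
    numDescents (x :: y :: t) =
      numDescents (y :: t) + if x = 1 ∧ y = 0 then 1 else 0 := by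
  simp [numDescents, List.countP_cons]

theorem numDescents_zero_cons (t : List (Fin 2)) : numDescents (0 :: t) = numDescents t := by
  cases t with
  | nil => rfl
  | cons y t => simp [numDescents_cons_cons]

/-- Descents occupy disjoint pairs of positions, each of which can supply either letter. -/
theorem sublist_of_length_le_numDescents :
    ∀ I J : List (Fin 2), I.length ≤ numDescents J → I.Sublist J
  | [], J, _ => J.nil_sublist
  | _ :: _, [], h => by simp [numDescents] at h
  | _ :: _, [_], h => by simp [numDescents] at h
  | a :: I, x :: y :: t, h => by
    rw [numDescents_cons_cons] at h
    by_cases hxy : x = 1 ∧ y = 0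
    · obtain ⟨rfl, rfl⟩ := hxy
      have ht : I.Sublist t := sublist_of_length_le_numDescents I t (by
        simpa [numDescents_zero_cons] using h)
      obtain rfl | rfl : a = 0 ∨ a = 1 := by lia
      · exact (ht.cons_cons 0).cons 1
      · exact (ht.cons 0).cons_cons 1
    · exact (sublist_of_length_le_numDescents (a :: I) (y :: t) (by
        simpa [hxy] using h)).cons x
  termination_by _ J => J.length

/-- If a word `J` over a two-letter alphabet has at least `2 · (length I)` descents,
then `I` embeds in `J` as a subsequence. -/
theorem sublist_of_many_descents (I J : List (Fin 2))
    (h : 2 * I.length ≤ numDescents J) : I.Sublist J :=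
  sublist_of_length_le_numDescents I J (by lia)
end

section
/- Let m : ℕ and let μ : List (Fin m) → ℤ be any function. For a list I, let Δ_I = { μ J : J is a proper sublist of I (a sublist of I with J ≠ I) }. Then the set of lists I such that μ I does not lie in the ideal of ℤ generated by Δ_I is finite. -/
/-- **Higman's lemma** for words over a finite alphabet. -/
theorem List.wellQuasiOrdered_sublist (α : Type*) [Finite α] :
    WellQuasiOrdered (List.Sublist : List α → List α → Prop) := by
  intro f
  obtain ⟨i, j, hij, h⟩ :=
    (Set.PartiallyWellOrderedOn.partiallyWellOrderedOn_sublistForall₂ (· = ·)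
      (Set.finite_univ (α := α)).partiallyWellOrderedOn).exists_lt (f := f)
      fun _ _ _ => Set.mem_univ _
  obtain ⟨l, hl, hs⟩ := List.sublistForall₂_iff.1 h
  rw [List.forall₂_eq_eq_eq] at hl
  exact ⟨i, j, hij, hl ▸ hs⟩

/-- For any integer-valued function `μ` on words over an `m`-letter alphabet, there are
only finitely many words `I` such that `μ I` does not lie in the ideal of `ℤ` generated
by the values of `μ` on proper sublists of `I`.  (This is the combinatorial content of
the fact that a link has only finitely many nonvanishing Milnor μ̄-invariants.) -/
theorem finitely_many_nonvanishing_mu_invariants (m : ℕ) (μ : List (Fin m) → ℤ) :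
    {I : List (Fin m) |
      μ I ∉ Ideal.span {x : ℤ | ∃ J : List (Fin m), J.Sublist I ∧ J ≠ I ∧ μ J = x}}.Finite := by
  by_contra hinf
  let f := Set.Infinite.natEmbedding _ hinf
  have : IsPreorder (List (Fin m)) List.Sublist :=
    { refl := List.Sublist.refl
      trans := fun _ _ _ => List.Sublist.trans }
  obtain ⟨g, hg⟩ := (List.wellQuasiOrdered_sublist (Fin m)).exists_monotone_subseq
    fun n => (f n : List (Fin m))
  let A : ℕ →o Ideal ℤ :=
    { toFun := fun n => Ideal.span {x : ℤ | ∃ J : List (Fin m),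
        J.Sublist (f (g n)) ∧ J ≠ f (g n) ∧ μ J = x}
      monotone' := fun i j hij => Ideal.span_mono <| by
        rintro x ⟨J, hJ, hne, rfl⟩
        refine ⟨J, hJ.trans (hg i j hij), ?_, rfl⟩
        rintro rfl
        exact hne (hJ.antisymm (hg i j hij)) }
  obtain ⟨N, hN⟩ := monotone_stabilizes_iff_noetherian.2 inferInstance A
  refine (f (g N)).2 ?_
  change μ (f (g N)) ∈ A N
  rw [hN (N + 1) N.le_succ]
  refine Ideal.subset_span ⟨_, hg N (N + 1) N.le_succ, fun h => ?_, rfl⟩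
  exact N.lt_succ_self.ne (g.injective (f.injective (Subtype.ext h)))
end

section
/- The central binomial power series is not rational: for f = PowerSeries.mk (fun k => (Nat.centralBinom k : ℤ)) ∈ PowerSeries ℤ, whose k-th coefficient is the central binomial coefficient C(2k,k) (so f is the formal expansion of (1−4x)^{−1/2}), there exist no polynomials P, Q ∈ Polynomial ℤ with f * (1 + X * Q) = P in PowerSeries ℤ. -/
/-- A prime `p` divides `C(2k,k)` whenever `k < p ≤ 2k`. -/
lemma Nat.Prime.dvd_centralBinom {p k : ℕ} (hp : p.Prime) (hk : k < p) (h : p ≤ 2 * k) :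
    p ∣ k.centralBinom := by
  rw [Nat.centralBinom_eq_two_mul_choose, two_mul]
  exact hp.dvd_choose_add hk hk (by omega)

/-- By Lucas' theorem `C(2p,p) ≡ 2` modulo a prime `p`. -/
lemma Nat.Prime.centralBinom_self_modEq {p : ℕ} (hp : p.Prime) :
    p.centralBinom ≡ 2 [MOD p] := by
  have : Fact p.Prime := ⟨hp⟩
  have h := Choose.choose_modEq_choose_mod_mul_choose_div_nat (p := p) (n := 2 * p) (k := p)
  simpa [Nat.centralBinom_eq_two_mul_choose, Nat.mul_div_cancel _ hp.pos,
    Nat.div_self hp.pos] using h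

/-- If `f * (1 + X * Q)` is a polynomial of degree at most `m` and `d` divides the coefficients
of `f` with indices in `[m - natDegree Q, m]`, then `d` divides the coefficient of index `m + 1`. -/
lemma PowerSeries.dvd_coeff_succ_of_mul_eq {R : Type*} [CommRing R] {f : PowerSeries R}
    {P Q : Polynomial R}
    (h : f * (1 + PowerSeries.X * (Q : PowerSeries R)) = (P : PowerSeries R))
    {m : ℕ} (hP : P.natDegree ≤ m) {d : R}
    (hd : ∀ a ≤ m, m ≤ a + Q.natDegree → d ∣ coeff a f) :
    d ∣ coeff (m + 1) f := by
  have hc := congrArg (coeff (m + 1)) h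
  rw [show f * (1 + X * (Q : PowerSeries R)) = f + X * (f * (Q : PowerSeries R)) by ring,
    map_add, coeff_succ_X_mul, Polynomial.coeff_coe,
    Polynomial.coeff_eq_zero_of_natDegree_lt (by omega)] at hc
  rw [eq_neg_of_add_eq_zero_left hc, dvd_neg, coeff_mul]
  refine Finset.dvd_sum fun x hx => ?_
  rw [Finset.HasAntidiagonal.mem_antidiagonal] at hx
  rw [Polynomial.coeff_coe]
  rcases le_or_gt x.2 Q.natDegree with hle | hlt
  · exact (hd x.1 (by omega) (by omega)).mul_right _
  · simp [Polynomial.coeff_eq_zero_of_natDegree_lt hlt]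

/-- The central binomial power series `∑ C(2k,k) xᵏ` (the formal expansion of
`(1 - 4x)^{-1/2}`) is not a rational power series. -/
theorem centralBinom_powerSeries_not_rational :
    ¬ ∃ P Q : Polynomial ℤ,
      (PowerSeries.mk fun k => (Nat.centralBinom k : ℤ)) *
        (1 + PowerSeries.X * (Q : PowerSeries ℤ)) = (P : PowerSeries ℤ) := by
  rintro ⟨P, Q, h⟩
  obtain ⟨p, hp_large, hp⟩ :=
    Nat.exists_infinite_primes (P.natDegree + 2 * Q.natDegree + 5)
  have hdvd : (p : ℤ) ∣ PowerSeries.coeff (p - 1 + 1)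
      (PowerSeries.mk fun k => (Nat.centralBinom k : ℤ)) := by
    refine PowerSeries.dvd_coeff_succ_of_mul_eq h (by omega) fun a ha hQ => ?_
    rw [PowerSeries.coeff_mk]
    exact_mod_cast hp.dvd_centralBinom (by omega) (by omega)
  rw [PowerSeries.coeff_mk, Nat.sub_add_cancel hp.one_le, Int.natCast_dvd_natCast,
    hp.centralBinom_self_modEq.dvd_iff dvd_rfl] at hdvd
  have := Nat.le_of_dvd two_pos hdvd
  omega
end

section
/- The factorial power series is not rational: for f = PowerSeries.mk (fun k => (k.factorial : ℤ)) ∈ PowerSeries ℤ, there exist no polynomials P, Q ∈ Polynomial ℤ with f * (1 + X * Q) = P in PowerSeries ℤ. -/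
/-- The sum of the absolute values of finitely many coefficients of an integer polynomial is at
most the sum over its support. -/
theorem Polynomial.sum_abs_coeff_le_sum_support (Q : Polynomial ℤ) (s : Finset ℕ) :
    ∑ k ∈ s, |Q.coeff k| ≤ ∑ k ∈ Q.support, |Q.coeff k| := by
  rw [← Finset.sum_filter_ne_zero]
  exact Finset.sum_le_sum_of_subset_of_nonneg (fun k hk => by simp_all)
    fun k _ _ => abs_nonneg _

/-- The coefficients of `Q * ∑ k! xᵏ` grow at most like the factorials. -/
theorem Polynomial.abs_coeff_mul_factorial_powerSeries_le (Q : Polynomial ℤ) (m : ℕ) :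
    |PowerSeries.coeff m
        ((Q : PowerSeries ℤ) * PowerSeries.mk fun k => (Nat.factorial k : ℤ))| ≤
      (∑ k ∈ Q.support, |Q.coeff k|) * (Nat.factorial m : ℤ) := by
  rw [PowerSeries.coeff_mul, Finset.Nat.sum_antidiagonal_eq_sum_range_succ_mk]
  calc
    _ ≤ ∑ k ∈ Finset.range (m + 1), |Q.coeff k| * (Nat.factorial m : ℤ) := by
      refine (Finset.abs_sum_le_sum_abs _ _).trans (Finset.sum_le_sum fun k _ => ?_)
      rw [Polynomial.coeff_coe, PowerSeries.coeff_mk, abs_mul, Nat.abs_cast]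
      gcongr
      exact Nat.sub_le m k
    _ ≤ _ := by
      rw [← Finset.sum_mul]
      exact mul_le_mul_of_nonneg_right (Q.sum_abs_coeff_le_sum_support _) (Nat.cast_nonneg _)

/-- The factorial power series `∑ k! xᵏ` is not a rational power series. -/
theorem factorial_powerSeries_not_rational :
    ¬ ∃ P Q : Polynomial ℤ,
      (PowerSeries.mk fun k => (Nat.factorial k : ℤ)) *
        (1 + PowerSeries.X * (Q : PowerSeries ℤ)) = (P : PowerSeries ℤ) := by
  rintro ⟨P, Q, h⟩
  set S : ℤ := ∑ k ∈ Q.support, |Q.coeff k|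
  set m : ℕ := P.natDegree + S.toNat with hm
  have hcoeff := congrArg (PowerSeries.coeff (m + 1)) h
  rw [mul_add, mul_one, mul_comm, mul_assoc, map_add, PowerSeries.coeff_succ_X_mul,
    PowerSeries.coeff_mk, Polynomial.coeff_coe,
    Polynomial.coeff_eq_zero_of_natDegree_lt (by omega), Nat.factorial_succ] at hcoeff
  have hbound := (abs_le.mp (Q.abs_coeff_mul_factorial_powerSeries_le m)).1
  have hpos : (0 : ℤ) < Nat.factorial m := mod_cast Nat.factorial_pos m
  have hSm : S < (m : ℤ) + 1 := by omega
  push_cast at hcoeff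
  have := mul_lt_mul_of_pos_right hSm hpos
  linarith
end
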